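/- Let q be a layered pattern of length k ≥ 1. Then the limit inferior of the sequence (S_n(q))^{1/n} is at least (k−1)². -/

import Mathlib

/-- A permutation `p` of length `n` contains the pattern `q` of length `k`:
there are positions `f 0 < f 1 < … < f (k-1)` whose values are order-isomorphic to `q`. -/
def PermContains {n k : ℕ} (p : Equiv.Perm (Fin n)) (q : Equiv.Perm (Fin k)) : Prop :=
  ∃ f : Fin k → Fin n, StrictMono f ∧ ∀ a b : Fin k, p (f a) < p (f b) ↔ q a < q b

/-- `p` avoids the pattern `q`. -/
def PermAvoids {n k : ℕ} (p : Equiv.Perm (Fin n)) (q : Equiv.Perm (Fin k)) : Prop :=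
  ¬ PermContains p q

/-- `avoiders n q` is `S_n(q)`, the number of permutations of length `n` avoiding `q`. -/
noncomputable def avoiders (n : ℕ) {k : ℕ} (q : Equiv.Perm (Fin k)) : ℕ :=
  Nat.card {p : Equiv.Perm (Fin n) // PermAvoids p q}

/-- The pattern 12453 (0-indexed: 0,1,3,4,2). -/
def pat12453 : Equiv.Perm (Fin 5) :=
  ⟨![0, 1, 3, 4, 2], ![0, 1, 4, 2, 3], by decide, by decide⟩

/-- `p i` is a left-to-right minimum of `p`: every earlier entry is larger. -/
def IsLtrMin {n : ℕ} (p : Equiv.Perm (Fin n)) (i : Fin n) : Prop :=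
  ∀ j : Fin n, j < i → p i < p j

/-- The sequence `s` contains the pattern `q` using only positions satisfying `P`:
there is a subsequence, supported on positions satisfying `P`, order-isomorphic to `q`.
Taking `P := fun _ => True` gives ordinary pattern containment in the sequence `s`;
taking `P i := ¬ IsLtrMin p i` and `s := p` gives pattern containment in the string
of remaining entries of a permutation `p`. -/
def ContainsOn {α : Type*} [LinearOrder α] {m k : ℕ} (s : Fin m → α)
    (P : Fin m → Prop) (q : Equiv.Perm (Fin k)) : Prop :=
  ∃ f : Fin k → Fin m, StrictMono f ∧ (∀ a : Fin k, P (f a)) ∧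
    ∀ a b : Fin k, s (f a) < s (f b) ↔ q a < q b

/-- A pattern `q` of length `k` is indecomposable if it cannot be cut into two parts
so that all entries before the cut are larger than all entries after the cut:
there is no `r` with `1 ≤ r < k` such that the first `r` positions carry exactly
the top `r` values `{k-r, …, k-1}` (0-indexed). -/
def Indecomposable {k : ℕ} (q : Equiv.Perm (Fin k)) : Prop :=
  ¬ ∃ r : ℕ, 1 ≤ r ∧ r < k ∧ ∀ i : Fin k, ((i : ℕ) < r ↔ k - r ≤ (q i : ℕ))

/-- A pattern `q` is layered: positions can be labelled by a monotone block function `b`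
(whose fibers are then consecutive intervals, the layers) such that `q` is decreasing
within each layer and entries in earlier layers are smaller than those in later layers,
i.e. for `i < j`, `q j < q i` exactly when `i` and `j` are in the same layer. -/
def Layered {k : ℕ} (q : Equiv.Perm (Fin k)) : Prop :=
  ∃ b : Fin k → ℕ, Monotone b ∧ ∀ i j : Fin k, i < j → (q j < q i ↔ b i = b j)

/-- A finite set of lattice points contains the permutation matrix of `q`. -/
def MatContains {k : ℕ} (M : Finset (ℕ × ℕ)) (q : Equiv.Perm (Fin k)) : Prop :=
  ∃ f g : Fin k → ℕ, StrictMono f ∧ StrictMono g ∧ ∀ i, (f i, g (q i)) ∈ M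

/-- The set of `K × K` blocks met by `M`. -/
def blockSet (K : ℕ) (M : Finset (ℕ × ℕ)) : Finset (ℕ × ℕ) :=
  M.image fun z => (z.1 / K, z.2 / K)

/-- The points of `M` in the block `b`. -/
def inBlock (K : ℕ) (M : Finset (ℕ × ℕ)) (b : ℕ × ℕ) : Finset (ℕ × ℕ) :=
  M.filter fun z => (z.1 / K, z.2 / K) = b

theorem MatContains.of_blockSet {k K : ℕ} {M : Finset (ℕ × ℕ)} {q : Equiv.Perm (Fin k)}
    (h : MatContains (blockSet K M) q) : MatContains M q := by
  obtain ⟨f, g, hf, hg, h⟩ := h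
  have h' : ∀ i, ∃ z ∈ M, z.1 / K = f i ∧ z.2 / K = g (q i) := by
    intro i
    obtain ⟨z, hz, e⟩ := Finset.mem_image.1 (h i)
    exact ⟨z, hz, (Prod.mk.inj e).1, (Prod.mk.inj e).2⟩
  choose z hzM hz1 hz2 using h'
  refine ⟨fun i => (z i).1, fun j => (z (q.symm j)).2, ?_, ?_, ?_⟩
  · intro a b hab
    refine Nat.lt_of_div_lt_div (c := K) ?_
    rw [hz1, hz1]
    exact hf hab
  · intro a b hab
    refine Nat.lt_of_div_lt_div (c := K) ?_
    rw [hz2, hz2]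
    simpa using hg hab
  · intro i
    simpa using hzM i

theorem MatContains.swap {k : ℕ} {M : Finset (ℕ × ℕ)} {q : Equiv.Perm (Fin k)}
    (h : MatContains (M.image Prod.swap) q.symm) : MatContains M q := by
  obtain ⟨f, g, hf, hg, h⟩ := h
  refine ⟨g, f, hg, hf, fun i => ?_⟩
  have := h (q i)
  simpa using this

theorem card_wide_column_le {k K : ℕ} {M : Finset (ℕ × ℕ)} {q : Equiv.Perm (Fin k)}
    (hM : ¬ MatContains M q) (hK : 0 < K) (u : ℕ) (V : Finset ℕ)
    (hV : ∀ v ∈ V, k ≤ ((inBlock K M (u, v)).image Prod.fst).card) :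
    V.card ≤ K.choose k * k := by
  by_contra! hcon
  have hs : ∀ v : ℕ, ∃ S : Finset ℕ, v ∈ V →
      S ⊆ (inBlock K M (u, v)).image Prod.fst ∧ S.card = k := by
    intro v
    by_cases hv : v ∈ V
    · obtain ⟨S, h1, h2⟩ := Finset.exists_subset_card_eq (hV v hv)
      exact ⟨S, fun _ => ⟨h1, h2⟩⟩
    · exact ⟨∅, fun h => absurd h hv⟩
  choose s hs using hs
  have hmaps : ∀ v ∈ V, s v ∈ Finset.powersetCard k (Finset.Ico (u * K) (u * K + K)) := by
    intro v hv
    refine Finset.mem_powersetCard.2 ⟨fun c hc => ?_, (hs v hv).2⟩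
    obtain ⟨z, hz, rfl⟩ := Finset.mem_image.1 ((hs v hv).1 hc)
    have h1 := (Prod.mk.inj (Finset.mem_filter.1 hz).2).1
    rw [Finset.mem_Ico]
    have hdm := Nat.div_add_mod z.1 K
    have := Nat.mod_lt z.1 hK
    rw [h1, mul_comm] at hdm
    omega
  obtain ⟨S, -, hS⟩ := Finset.exists_lt_card_fiber_of_mul_lt_card_of_maps_to hmaps
    (n := k) (by simpa [Finset.card_powersetCard] using hcon)
  set W := V.filter fun v => s v = S
  have hWS : ∀ v ∈ W, ∀ c ∈ S, ∃ z ∈ M, z.1 = c ∧ z.2 / K = v := by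
    intro v hv c hc
    obtain ⟨hv', hvS⟩ := Finset.mem_filter.1 hv
    rw [← hvS] at hc
    obtain ⟨z, hz, rfl⟩ := Finset.mem_image.1 ((hs v hv').1 hc)
    exact ⟨z, (Finset.mem_filter.1 hz).1, rfl, (Prod.mk.inj (Finset.mem_filter.1 hz).2).2⟩
  have hSk : S.card = k := by
    obtain ⟨v, hv⟩ := Finset.card_pos.1 (lt_of_le_of_lt (Nat.zero_le _) hS)
    obtain ⟨hv', hvS⟩ := Finset.mem_filter.1 hv
    rw [← hvS]
    exact (hs v hv').2
  have h' : ∀ i : Fin k, ∃ z ∈ M, z.1 = S.orderEmbOfFin hSk i ∧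
      z.2 / K = W.orderEmbOfCardLe hS.le (q i) := fun i =>
    hWS _ (Finset.orderEmbOfCardLe_mem _ _ _) _ (Finset.orderEmbOfFin_mem _ _ _)
  choose z hzM hz1 hz2 using h'
  refine hM ⟨fun i => (z i).1, fun j => (z (q.symm j)).2, ?_, ?_, ?_⟩
  · intro a b hab
    simp only [hz1]
    simpa using hab
  · intro a b hab
    refine Nat.lt_of_div_lt_div (c := K) ?_
    rw [hz2, hz2]
    simpa using hab
  · intro i
    simpa using hzM i

theorem card_wide_le {k K n : ℕ} {M : Finset (ℕ × ℕ)} {q : Equiv.Perm (Fin k)}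
    (hM : ¬ MatContains M q) (hK : 0 < K) (B : Finset (ℕ × ℕ)) (hBn : ∀ b ∈ B, b.1 < n)
    (hB : ∀ b ∈ B, k ≤ ((inBlock K M b).image Prod.fst).card) :
    B.card ≤ n * (K.choose k * k) := by
  have := Finset.card_le_mul_card_image_of_maps_to (s := B) (t := Finset.range n) (f := Prod.fst)
    (fun b hb => Finset.mem_range.2 (hBn b hb)) (K.choose k * k) (by
      intro u _
      have h1 := card_wide_column_le hM hK u ((B.filter fun b => b.1 = u).image Prod.snd) (by
        intro v hv
        obtain ⟨b, hb, rfl⟩ := Finset.mem_image.1 hv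
        obtain ⟨hb', rfl⟩ := Finset.mem_filter.1 hb
        exact hB b hb')
      rwa [Finset.card_image_of_injOn] at h1
      intro b hb c hc h
      simp only [Finset.coe_filter, Set.mem_ofPred_eq] at hb hc
      exact Prod.ext (hb.2.trans hc.2.symm) h)
  rw [Finset.card_range] at this
  linarith [mul_comm n (K.choose k * k)]

theorem inBlock_swap (K : ℕ) (M : Finset (ℕ × ℕ)) (b : ℕ × ℕ) :
    (inBlock K (M.image Prod.swap) b.swap).image Prod.fst = (inBlock K M b).image Prod.snd := by
  ext c
  simp only [inBlock, Finset.mem_image, Finset.mem_filter, Prod.exists, Prod.ext_iff, Prod.swap]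
  constructor
  · rintro ⟨x, y, ⟨⟨x', y', h, rfl, rfl⟩, h1, h2⟩, rfl⟩
    exact ⟨x', y', ⟨h, h2, h1⟩, rfl⟩
  · rintro ⟨x, y, ⟨h, h1, h2⟩, rfl⟩
    exact ⟨y, x, ⟨⟨x, y, h, rfl, rfl⟩, h2, h1⟩, rfl⟩

theorem card_tall_le {k K n : ℕ} {M : Finset (ℕ × ℕ)} {q : Equiv.Perm (Fin k)}
    (hM : ¬ MatContains M q) (hK : 0 < K) (B : Finset (ℕ × ℕ)) (hBn : ∀ b ∈ B, b.2 < n)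
    (hB : ∀ b ∈ B, k ≤ ((inBlock K M b).image Prod.snd).card) :
    B.card ≤ n * (K.choose k * k) := by
  have h := card_wide_le (k := k) (K := K) (n := n) (M := M.image Prod.swap) (q := q.symm)
    (fun h => hM h.swap) hK (B.image Prod.swap)
    (by
      intro b hb
      obtain ⟨c, hc, rfl⟩ := Finset.mem_image.1 hb
      exact hBn c hc)
    (by
      intro b hb
      obtain ⟨c, hc, rfl⟩ := Finset.mem_image.1 hb
      rw [inBlock_swap]
      exact hB c hc)
  rwa [Finset.card_image_of_injective _ Prod.swap_injective] at h

theorem card_inBlock_le (K : ℕ) (hK : 0 < K) (M : Finset (ℕ × ℕ)) (b : ℕ × ℕ) :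
    (inBlock K M b).card ≤ K ^ 2 := by
  have h : inBlock K M b ⊆
      Finset.Ico (b.1 * K) (b.1 * K + K) ×ˢ Finset.Ico (b.2 * K) (b.2 * K + K) := by
    intro z hz
    obtain ⟨-, rfl⟩ := Finset.mem_filter.1 hz
    simp only [Finset.mem_product, Finset.mem_Ico]
    have := Nat.div_add_mod z.1 K
    have := Nat.mod_lt z.1 hK
    have := Nat.div_add_mod z.2 K
    have := Nat.mod_lt z.2 hK
    rw [mul_comm (z.1 / K), mul_comm (z.2 / K)]
    omega
  have := Finset.card_le_card h
  simpa [sq] using this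

theorem card_eq_sum_inBlock (K : ℕ) (M : Finset (ℕ × ℕ)) :
    M.card = ∑ b ∈ blockSet K M, (inBlock K M b).card :=
  Finset.card_eq_sum_card_fiberwise fun _ hz => Finset.mem_coe.2 (Finset.mem_image_of_mem _ hz)

theorem blockSet_subset {K n : ℕ} {M : Finset (ℕ × ℕ)}
    (h : M ⊆ Finset.range (K * n) ×ˢ Finset.range (K * n)) :
    blockSet K M ⊆ Finset.range n ×ˢ Finset.range n := by
  intro b hb
  obtain ⟨z, hz, rfl⟩ := Finset.mem_image.1 hb
  have := Finset.mem_product.1 (h hz)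
  simp only [Finset.mem_product, Finset.mem_range] at this ⊢
  exact ⟨Nat.div_lt_of_lt_mul this.1, Nat.div_lt_of_lt_mul this.2⟩

theorem card_le_blockSet {k K n : ℕ} {M : Finset (ℕ × ℕ)} {q : Equiv.Perm (Fin k)}
    (hM : ¬ MatContains M q) (hK : 0 < K)
    (h : M ⊆ Finset.range (K * n) ×ˢ Finset.range (K * n)) :
    M.card ≤ (k - 1) ^ 2 * (blockSet K M).card + 2 * K ^ 2 * (K.choose k * k) * n := by
  classical
  set Bw := (blockSet K M).filter fun b => k ≤ ((inBlock K M b).image Prod.fst).card with hBw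
  set Bt := (blockSet K M).filter fun b => k ≤ ((inBlock K M b).image Prod.snd).card with hBt
  have hn := blockSet_subset h
  have hw : Bw.card ≤ n * (K.choose k * k) := card_wide_le hM hK _
    (fun b hb => by
      have := hn (Finset.mem_filter.1 hb).1
      simp only [Finset.mem_product, Finset.mem_range] at this
      exact this.1)
    (fun b hb => (Finset.mem_filter.1 hb).2)
  have ht : Bt.card ≤ n * (K.choose k * k) := card_tall_le hM hK _
    (fun b hb => by
      have := hn (Finset.mem_filter.1 hb).1
      simp only [Finset.mem_product, Finset.mem_range] at this
      exact this.2)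
    (fun b hb => (Finset.mem_filter.1 hb).2)
  have hb : ∀ b ∈ blockSet K M, (inBlock K M b).card ≤
      (k - 1) ^ 2 + ((if b ∈ Bw then K ^ 2 else 0) + if b ∈ Bt then K ^ 2 else 0) := by
    intro b hb
    have h1 := card_inBlock_le K hK M b
    by_cases h2 : b ∈ Bw
    · simp only [h2, if_true]; omega
    by_cases h3 : b ∈ Bt
    · simp only [h3, if_true]; omega
    simp only [hBw, hBt, Finset.mem_filter, hb, true_and, not_le] at h2 h3
    have h4 : (inBlock K M b).card ≤
        ((inBlock K M b).image Prod.fst).card * ((inBlock K M b).image Prod.snd).card := by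
      rw [← Finset.card_product]
      exact Finset.card_le_card Finset.subset_product
    have h5 := Nat.mul_le_mul (Nat.le_sub_one_of_lt h2) (Nat.le_sub_one_of_lt h3)
    rw [sq]
    omega
  rw [card_eq_sum_inBlock K M]
  refine (Finset.sum_le_sum hb).trans ?_
  rw [Finset.sum_add_distrib, Finset.sum_add_distrib, Finset.sum_const, ← Finset.sum_filter,
    ← Finset.sum_filter, Finset.sum_const, Finset.sum_const]
  have e1 : (blockSet K M).filter (fun b => b ∈ Bw) = Bw := by
    ext b; simp only [hBw, Finset.mem_filter]; tauto
  have e2 : (blockSet K M).filter (fun b => b ∈ Bt) = Bt := by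
    ext b; simp only [hBt, Finset.mem_filter]; tauto
  rw [e1, e2]
  simp only [smul_eq_mul]
  have := Nat.mul_le_mul_right (K ^ 2) hw
  have := Nat.mul_le_mul_right (K ^ 2) ht
  nlinarith

/-- The Marcus–Tardos bound along powers of `k ^ 2 + 1`. -/
theorem exists_card_le_of_not_matContains {k : ℕ} (q : Equiv.Perm (Fin k)) :
    ∃ C : ℕ, ∀ (j : ℕ) (M : Finset (ℕ × ℕ)), ¬ MatContains M q →
      M ⊆ Finset.range ((k ^ 2 + 1) ^ j) ×ˢ Finset.range ((k ^ 2 + 1) ^ j) →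
      M.card ≤ C * (k ^ 2 + 1) ^ j := by
  set K := k ^ 2 + 1 with hK
  refine ⟨2 * K ^ 2 * (K.choose k * k) + 1, fun j => ?_⟩
  set c := 2 * K ^ 2 * (K.choose k * k) with hc
  induction j with
  | zero =>
    intro M _ h
    have := Finset.card_le_card h
    simp at this
    simp; omega
  | succ j ih =>
    intro M hM h
    rw [pow_succ'] at h
    have h1 := card_le_blockSet hM (Nat.succ_pos _) h
    have h2 := ih (blockSet K M) (fun h => hM h.of_blockSet) (blockSet_subset h)
    have h3 : (k - 1) ^ 2 ≤ k ^ 2 := Nat.pow_le_pow_left (Nat.sub_le _ _) 2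
    calc M.card ≤ (k - 1) ^ 2 * (blockSet K M).card + c * K ^ j := h1
      _ ≤ k ^ 2 * ((c + 1) * K ^ j) + (c + 1) * K ^ j := by gcongr; omega
      _ = (c + 1) * K ^ (j + 1) := by rw [hK]; ring

/-- The sets of lattice points in `[0, n)²` that avoid `q`. -/
noncomputable def matAvoiders {k : ℕ} (q : Equiv.Perm (Fin k)) (n : ℕ) :
    Finset (Finset (ℕ × ℕ)) :=
  open Classical in
  (Finset.range n ×ˢ Finset.range n).powerset.filter fun M => ¬ MatContains M q

theorem card_matAvoiders_mul_le {k : ℕ} (q : Equiv.Perm (Fin k)) {K n F : ℕ} (hK : 0 < K)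
    (hF : ∀ M ∈ matAvoiders q n, M.card ≤ F) :
    (matAvoiders q (K * n)).card ≤ 2 ^ (K ^ 2 * F) * (matAvoiders q n).card := by
  classical
  refine Finset.card_le_mul_card_image_of_maps_to (f := blockSet K) ?_ _ ?_
  · intro M hM
    simp only [matAvoiders, Finset.mem_filter, Finset.mem_powerset] at hM ⊢
    exact ⟨blockSet_subset hM.1, fun h => hM.2 h.of_blockSet⟩
  · intro B hB
    set U := B.biUnion fun b => inBlock K (Finset.range (K * n) ×ˢ Finset.range (K * n)) b
    have hU : U.card ≤ K ^ 2 * F :=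
      calc U.card ≤ ∑ b ∈ B, (inBlock K (Finset.range (K * n) ×ˢ Finset.range (K * n)) b).card :=
            Finset.card_biUnion_le
        _ ≤ ∑ _b ∈ B, K ^ 2 := Finset.sum_le_sum fun b _ => card_inBlock_le K hK _ b
        _ = K ^ 2 * B.card := by rw [Finset.sum_const, smul_eq_mul, mul_comm]
        _ ≤ K ^ 2 * F := Nat.mul_le_mul_left _ (hF B hB)
    have : (matAvoiders q (K * n)).filter (fun M => blockSet K M = B) ⊆ U.powerset := by
      intro M hM
      simp only [matAvoiders, Finset.mem_filter, Finset.mem_powerset] at hM ⊢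
      obtain ⟨⟨h1, -⟩, rfl⟩ := hM
      intro z hz
      exact Finset.mem_biUnion.2 ⟨_, Finset.mem_image_of_mem _ hz,
        Finset.mem_filter.2 ⟨h1 hz, rfl⟩⟩
    calc _ ≤ U.powerset.card := Finset.card_le_card this
      _ = 2 ^ U.card := Finset.card_powerset _
      _ ≤ _ := Nat.pow_le_pow_right (by norm_num) hU

theorem exists_card_matAvoiders_le {k : ℕ} (hk : 1 ≤ k) (q : Equiv.Perm (Fin k)) :
    ∃ D : ℕ, ∀ j : ℕ,
      (matAvoiders q ((k ^ 2 + 1) ^ j)).card ≤ 2 ^ (D * (k ^ 2 + 1) ^ j) := by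
  obtain ⟨C, hC⟩ := exists_card_le_of_not_matContains q
  set K := k ^ 2 + 1 with hK
  have hK2 : 2 ≤ K := by nlinarith
  refine ⟨K ^ 2 * C + 1, fun j => ?_⟩
  induction j with
  | zero =>
    have : (matAvoiders q (K ^ 0)).card ≤ 2 := by
      classical
      unfold matAvoiders
      exact (Finset.card_le_card (Finset.filter_subset _ _)).trans (by simp)
    refine this.trans ?_
    rw [pow_zero, mul_one, pow_succ]
    exact Nat.le_mul_of_pos_left 2 (by positivity)
  | succ j ih =>
    have h := card_matAvoiders_mul_le q (K := K) (n := K ^ j) (F := C * K ^ j) (by omega) (by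
      intro M hM
      simp only [matAvoiders, Finset.mem_filter, Finset.mem_powerset] at hM
      exact hC j M hM.2 hM.1)
    rw [pow_succ']
    calc _ ≤ _ := h
      _ ≤ 2 ^ (K ^ 2 * (C * K ^ j)) * 2 ^ ((K ^ 2 * C + 1) * K ^ j) := Nat.mul_le_mul_left _ ih
      _ = 2 ^ (K ^ 2 * (C * K ^ j) + (K ^ 2 * C + 1) * K ^ j) := (pow_add _ _ _).symm
      _ ≤ _ := by
        refine Nat.pow_le_pow_right (by norm_num) ?_
        have : (K ^ 2 * C + 1) * K ^ j * 2 ≤ (K ^ 2 * C + 1) * K ^ j * K :=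
          Nat.mul_le_mul_left _ hK2
        nlinarith [Nat.zero_le (K ^ j)]

theorem avoiders_le_card_matAvoiders {k : ℕ} (q : Equiv.Perm (Fin k)) (n : ℕ) :
    avoiders n q ≤ (matAvoiders q n).card := by
  classical
  have hmem : ∀ (p : Equiv.Perm (Fin n)) (z : ℕ × ℕ),
      z ∈ Finset.univ.image (fun i : Fin n => ((i : ℕ), (p i : ℕ))) ↔
        ∃ i : Fin n, ((i : ℕ), (p i : ℕ)) = z := fun p z => by simp
  let Φ : {p : Equiv.Perm (Fin n) // PermAvoids p q} → matAvoiders q n := fun p =>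
    ⟨Finset.univ.image fun i : Fin n => ((i : ℕ), (p.1 i : ℕ)), by
      simp only [matAvoiders, Finset.mem_filter, Finset.mem_powerset]
      refine ⟨fun z hz => ?_, ?_⟩
      · obtain ⟨i, rfl⟩ := (hmem _ _).1 hz
        simp
      · rintro ⟨f, g, hf, hg, h⟩
        have h' : ∀ a, ∃ i : Fin n, (i : ℕ) = f a ∧ (p.1 i : ℕ) = g (q a) := by
          intro a
          obtain ⟨i, hi⟩ := (hmem _ _).1 (h a)
          exact ⟨i, (Prod.mk.inj hi).1, (Prod.mk.inj hi).2⟩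
        choose F hF1 hF2 using h'
        refine p.2 ⟨F, fun a b hab => ?_, fun a b => ?_⟩
        · rw [Fin.lt_def, hF1, hF1]
          exact hf hab
        · rw [Fin.lt_def, hF2, hF2]
          exact hg.lt_iff_lt⟩
  have hΦ : Function.Injective Φ := by
    intro p p' h
    have h : Finset.univ.image (fun i : Fin n => ((i : ℕ), (p.1 i : ℕ))) =
        Finset.univ.image fun i : Fin n => ((i : ℕ), (p'.1 i : ℕ)) := Subtype.ext_iff.1 h
    refine Subtype.ext (Equiv.ext fun i => ?_)
    have hi : ((i : ℕ), (p.1 i : ℕ)) ∈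
        Finset.univ.image fun i : Fin n => ((i : ℕ), (p'.1 i : ℕ)) := by
      rw [← h]
      exact (hmem p.1 _).2 ⟨i, rfl⟩
    obtain ⟨i', hi'⟩ := (hmem _ _).1 hi
    have e1 := Fin.ext (Prod.mk.inj hi').1
    subst e1
    exact (Fin.ext (Prod.mk.inj hi').2).symm
  have := Nat.card_le_card_of_injective Φ hΦ
  rwa [Nat.card_eq_fintype_card (α := matAvoiders q n), Fintype.card_coe] at this

/-- The sequence `S_n(q)^(1/n)` does not tend to infinity. -/
theorem exists_frequently_avoiders_rpow_le {k : ℕ} (hk : 1 ≤ k) (q : Equiv.Perm (Fin k)) :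
    ∃ b : ℝ, ∃ᶠ n : ℕ in Filter.atTop, (avoiders n q : ℝ) ^ (1 / (n : ℝ)) ≤ b := by
  obtain ⟨D, hD⟩ := exists_card_matAvoiders_le hk q
  refine ⟨2 ^ D, Filter.frequently_atTop.2 fun N => ⟨(k ^ 2 + 1) ^ N, ?_, ?_⟩⟩
  · exact (Nat.lt_pow_self (by nlinarith)).le
  · set n := (k ^ 2 + 1) ^ N with hn
    have hn0 : n ≠ 0 := by positivity
    have h : (avoiders n q : ℝ) ≤ ((2 : ℝ) ^ D) ^ n := by
      rw [← pow_mul]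
      exact_mod_cast (avoiders_le_card_matAvoiders q n).trans (hD N)
    calc (avoiders n q : ℝ) ^ (1 / (n : ℝ)) ≤ (((2 : ℝ) ^ D) ^ n) ^ (1 / (n : ℝ)) :=
          Real.rpow_le_rpow (by positivity) h (by positivity)
      _ = 2 ^ D := by
        rw [one_div, Real.pow_rpow_inv_natCast (by positivity) hn0]

/-- The points of `A`, with coordinates `x` and `z`, contain a copy of the pattern whose layers
have sizes `l`: each layer is an increasing chain, and lies to the left of and above all later
layers. -/
def HasLayers {ι : Type*} (x z : ι → ℕ) : List ℕ → Set ι → Prop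
  | [], _ => True
  | a :: l, A => ∃ (f : Fin a → ι) (C : Set ι), (∀ j, f j ∈ A) ∧ StrictMono (x ∘ f) ∧
      StrictMono (z ∘ f) ∧ C ⊆ A ∧ HasLayers x z l C ∧ ∀ j, ∀ i ∈ C, x (f j) < x i ∧ z i < z (f j)

theorem HasLayers.mono {ι : Type*} {x z : ι → ℕ} {l : List ℕ} {A B : Set ι}
    (h : HasLayers x z l A) (hAB : A ⊆ B) : HasLayers x z l B := by
  cases l with
  | nil => trivial
  | cons a l =>
    obtain ⟨f, C, h1, h2, h3, h4, h5, h6⟩ := h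
    exact ⟨f, C, fun j => hAB (h1 j), h2, h3, h4.trans hAB, h5, h6⟩

theorem HasLayers.image {ι κ : Type*} {x z : ι → ℕ} {x' z' : κ → ℕ} (φ : ι → κ) {l : List ℕ}
    {A : Set ι} (hx : ∀ i ∈ A, ∀ j ∈ A, x i < x j → x' (φ i) < x' (φ j))
    (hz : ∀ i ∈ A, ∀ j ∈ A, z i < z j → z' (φ i) < z' (φ j))
    (h : HasLayers x z l A) : HasLayers x' z' l (φ '' A) := by
  induction l generalizing A with
  | nil => trivial
  | cons a l ih =>
    obtain ⟨f, C, h1, h2, h3, h4, h5, h6⟩ := h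
    refine ⟨φ ∘ f, φ '' C, fun j => ⟨_, h1 j, rfl⟩, fun i j hij => hx _ (h1 i) _ (h1 j) (h2 hij),
      fun i j hij => hz _ (h1 i) _ (h1 j) (h3 hij), Set.image_mono h4,
      ih (fun i hi j hj => hx i (h4 hi) j (h4 hj)) (fun i hi j hj => hz i (h4 hi) j (h4 hj)) h5, ?_⟩
    rintro j _ ⟨i, hi, rfl⟩
    exact ⟨hx _ (h1 j) _ (h4 hi) (h6 j i hi).1, hz _ (h4 hi) _ (h1 j) (h6 j i hi).2⟩

theorem HasLayers.preimage {ι κ : Type*} {x z : ι → ℕ} (φ : κ → ι) {l : List ℕ} {A : Set ι}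
    (hA : A ⊆ Set.range φ) (h : HasLayers x z l A) :
    HasLayers (fun i => x (φ i)) (fun i => z (φ i)) l (φ ⁻¹' A) := by
  induction l generalizing A with
  | nil => trivial
  | cons a l ih =>
    obtain ⟨f, C, h1, h2, h3, h4, h5, h6⟩ := h
    choose g hg using fun j => hA (h1 j)
    obtain rfl : f = φ ∘ g := funext fun j => (hg j).symm
    exact ⟨g, φ ⁻¹' C, h1, h2, h3, Set.preimage_mono h4, ih (h4.trans hA) h5,
      fun j i hi => h6 j _ hi⟩

theorem HasLayers.nonempty {ι : Type*} {x z : ι → ℕ} {a : ℕ} {l : List ℕ} {A : Set ι}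
    (ha : 0 < a) (h : HasLayers x z (a :: l) A) : A.Nonempty := by
  obtain ⟨f, C, h1, -⟩ := h
  exact ⟨f ⟨0, ha⟩, h1 _⟩

/-- A copy of a pattern with at least two layers lies inside one summand of a direct sum. -/
theorem HasLayers.exists_block {ι : Type*} {x z blk : ι → ℕ} {a b : ℕ} {l : List ℕ} {A : Set ι}
    (ha : 0 < a) (hb : 0 < b) (hx : ∀ i ∈ A, ∀ j ∈ A, x i < x j → blk i ≤ blk j)
    (hz : ∀ i ∈ A, ∀ j ∈ A, z i < z j → blk i ≤ blk j) (h : HasLayers x z (a :: b :: l) A) :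
    ∃ t, HasLayers x z (a :: b :: l) {i ∈ A | blk i = t} := by
  obtain ⟨f, C, h1, h2, h3, h4, h5, h6⟩ := h
  have key : ∀ j, ∀ i ∈ C, blk (f j) = blk i := fun j i hi =>
    le_antisymm (hx _ (h1 j) _ (h4 hi) (h6 j i hi).1) (hz _ (h4 hi) _ (h1 j) (h6 j i hi).2)
  obtain ⟨c, hc⟩ := h5.nonempty hb
  have h0 : ∀ j, blk (f j) = blk c := fun j => key j c hc
  exact ⟨blk c, f, C, fun j => ⟨h1 j, h0 j⟩, h2, h3,
    fun i hi => ⟨h4 hi, by rw [← key ⟨0, ha⟩ i hi, h0]⟩, h5, h6⟩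

/-- The number of permutations of length `n` that avoid the layered pattern with layer sizes `l`. -/
noncomputable def layAvoid (n : ℕ) (l : List ℕ) : ℕ :=
  Nat.card {p : Equiv.Perm (Fin n) //
    ¬ HasLayers (fun i : Fin n => (i : ℕ)) (fun i => (p i : ℕ)) l Set.univ}

/-- `layAvoid n l` grows at least like `y ^ (2 * n)` for every `y < x`. -/
def Grows (l : List ℕ) (x : ℝ) : Prop :=
  ∀ y : ℝ, 0 < y → y < x → ∃ δ : ℝ, 0 < δ ∧ ∀ n : ℕ, δ * y ^ (2 * n) ≤ layAvoid n l

theorem Grows.of_le {l l' : List ℕ} {x : ℝ} (h : Grows l x)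
    (hl : ∀ n, layAvoid n l ≤ layAvoid n l') : Grows l' x := fun y hy hyx => by
  obtain ⟨δ, hδ, H⟩ := h y hy hyx
  exact ⟨δ, hδ, fun n => (H n).trans (by exact_mod_cast hl n)⟩

theorem exists_layers {k : ℕ} (q : Equiv.Perm (Fin k)) (hq : Layered q) (A : Finset (Fin k)) :
    ∃ l : List ℕ, (∀ a ∈ l, 0 < a) ∧ l.sum = A.card ∧
      HasLayers (fun i : Fin k => (i : ℕ)) (fun i => ((q i).rev : ℕ)) l A := by
  obtain ⟨b, hb, h⟩ := hq
  induction A using Finset.strongInduction with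
  | H A ih =>
    rcases A.eq_empty_or_nonempty with rfl | hA
    · exact ⟨[], by simp, by simp, trivial⟩
    obtain ⟨m, hmA, hm⟩ := Finset.exists_min_image A b hA
    set L := A.filter fun i => b i = b m with hL
    set C := A.filter fun i => ¬ b i = b m with hC
    have hmL : m ∈ L := Finset.mem_filter.2 ⟨hmA, rfl⟩
    obtain ⟨l, hl1, hl2, hl3⟩ := ih C (Finset.ssubset_iff_subset_ne.2
      ⟨Finset.filter_subset _ _, fun e => by
        have : m ∈ C := e ▸ hmA
        exact (Finset.mem_filter.1 this).2 rfl⟩)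
    refine ⟨L.card :: l, ?_, ?_, ?_⟩
    · intro a ha
      rcases List.mem_cons.1 ha with rfl | ha
      · exact Finset.card_pos.2 ⟨m, hmL⟩
      · exact hl1 a ha
    · rw [List.sum_cons, hl2, hL, hC, Finset.card_filter_add_card_filter_not]
    · have hf : ∀ j, L.orderEmbOfFin rfl j ∈ A ∧ b (L.orderEmbOfFin rfl j) = b m := fun j =>
        Finset.mem_filter.1 (Finset.orderEmbOfFin_mem L rfl j)
      refine ⟨fun j => L.orderEmbOfFin rfl j, C, fun j => (hf j).1, fun i j hij => ?_,
        fun i j hij => ?_, Finset.coe_subset.2 (Finset.filter_subset _ _), hl3, fun j i hi => ?_⟩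
      · simpa using hij
      · have h1 : L.orderEmbOfFin rfl i < L.orderEmbOfFin rfl j := by simpa using hij
        have h2 := (h _ _ h1).2 ((hf i).2.trans (hf j).2.symm)
        exact Fin.lt_def.1 (Fin.rev_lt_rev.2 h2)
      · obtain ⟨hiA, hib⟩ := Finset.mem_filter.1 (Finset.mem_coe.1 hi)
        have hlt : b (L.orderEmbOfFin rfl j) < b i := by
          rw [(hf j).2]
          exact lt_of_le_of_ne (hm i hiA) (Ne.symm hib)
        have hji : L.orderEmbOfFin rfl j < i := by
          by_contra! hcon
          exact absurd (hb hcon) (not_le.2 hlt)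
        refine ⟨hji, Fin.lt_def.1 (Fin.rev_lt_rev.2 ?_)⟩
        have h2 : ¬ q i < q (L.orderEmbOfFin rfl j) := fun h3 => hlt.ne ((h _ _ hji).1 h3)
        exact lt_of_le_of_ne (not_lt.1 h2) fun e => hji.ne (q.injective e)

theorem layAvoid_le_avoiders {k : ℕ} (q : Equiv.Perm (Fin k)) {l : List ℕ}
    (h : HasLayers (fun i : Fin k => (i : ℕ)) (fun i => ((q i).rev : ℕ)) l Set.univ) (n : ℕ) :
    layAvoid n l ≤ avoiders n q := by
  refine Nat.card_le_card_of_injective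
    (fun p => ⟨p.1.trans Fin.revPerm, fun ⟨f, hf, hfq⟩ => p.2 ?_⟩) ?_
  · refine (HasLayers.image f (fun i _ j _ hij => hf hij) (fun i _ j _ hij => ?_) h).mono
      (Set.subset_univ _)
    have h1 := (hfq j i).2 (Fin.rev_lt_rev.1 hij)
    simpa using h1
  · intro p p' h
    have h1 := Subtype.ext_iff.1 h
    refine Subtype.ext (Equiv.ext fun i => ?_)
    have := Equiv.congr_fun h1 i
    simpa using this

theorem layAvoid_one_cons_le_swap (n r : ℕ) : layAvoid n [1, r] ≤ layAvoid n [r, 1] := by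
  refine Nat.card_le_card_of_injective
    (fun p => ⟨(Fin.revPerm.trans p.1).trans Fin.revPerm, fun h => p.2 ?_⟩) ?_
  · obtain ⟨f, C, h1, h2, h3, h4, ⟨g, D, h5, -⟩, h6⟩ := h
    have h7 := fun j => h6 j _ (h5 0)
    refine ⟨fun _ => (g 0).rev, Set.range fun j : Fin r => (f j.rev).rev, fun _ => trivial,
      Subsingleton.strictMono _, Subsingleton.strictMono _, Set.subset_univ _, ?_, ?_⟩
    · refine ⟨fun j => (f j.rev).rev, ∅, fun j => ⟨j, rfl⟩, fun i j hij => ?_, fun i j hij => ?_,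
        Set.empty_subset _, trivial, by simp⟩
      · have : f j.rev < f i.rev := h2 (Fin.rev_lt_rev.2 hij)
        exact Fin.rev_lt_rev.2 this
      · have : (p.1 (f j.rev).rev).rev < (p.1 (f i.rev).rev).rev := h3 (Fin.rev_lt_rev.2 hij)
        exact Fin.rev_lt_rev.1 this
    · rintro - _ ⟨j, rfl⟩
      have h8 := h7 j.rev
      exact ⟨Fin.rev_lt_rev.2 (Fin.lt_def.2 h8.1), Fin.rev_lt_rev.1 (Fin.lt_def.2 h8.2)⟩
  · intro p p' h
    have h1 := Subtype.ext_iff.1 h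
    refine Subtype.ext (Equiv.ext fun i => ?_)
    have := Equiv.congr_fun h1 i.rev
    simpa using this

theorem hasLayers_replicate_one {ι : Type*} {x z : ι → ℕ} (k : ℕ) (f : Fin k → ι) {A : Set ι}
    (hA : ∀ j, f j ∈ A) (hx : StrictMono (x ∘ f)) (hz : StrictAnti (z ∘ f)) :
    HasLayers x z (List.replicate k 1) A := by
  induction k generalizing A with
  | zero => trivial
  | succ k ih =>
    refine ⟨fun _ => f 0, Set.range fun j : Fin k => f j.succ, fun _ => hA 0,
      Subsingleton.strictMono _, Subsingleton.strictMono _, ?_, ?_, ?_⟩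
    · rintro _ ⟨j, rfl⟩
      exact hA _
    · exact ih (fun j => f j.succ) (fun j => ⟨j, rfl⟩)
        (fun i j hij => hx (Fin.succ_lt_succ_iff.2 hij))
        (fun i j hij => hz (Fin.succ_lt_succ_iff.2 hij))
    · rintro - _ ⟨j, rfl⟩
      exact ⟨hx (Fin.succ_pos j), hz (Fin.succ_pos j)⟩

theorem layAvoid_replicate_one_le (n k : ℕ) :
    layAvoid n (List.replicate k 1) ≤ layAvoid n [k] := by
  refine Nat.card_le_card_of_injective
    (fun p => ⟨p.1.trans Fin.revPerm, fun ⟨f, C, _, h1, h2, _⟩ => p.2 ?_⟩) ?_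
  · refine hasLayers_replicate_one k f (fun _ => trivial) h1 fun i j hij => ?_
    exact Fin.rev_lt_rev.1 (Fin.lt_def.2 (h2 hij))
  · intro p p' h
    have h1 := Subtype.ext_iff.1 h
    refine Subtype.ext (Equiv.ext fun i => ?_)
    have := Equiv.congr_fun h1 i
    simpa using this

theorem grows_one_one : Grows [1, 1] 1 := by
  refine fun y hy hy1 => ⟨1, one_pos, fun n => ?_⟩
  rw [one_mul]
  have h : 1 ≤ layAvoid n [1, 1] := by
    have : Nonempty {p : Equiv.Perm (Fin n) //
        ¬ HasLayers (fun i : Fin n => (i : ℕ)) (fun i => (p i : ℕ)) [1, 1] Set.univ} := by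
      refine ⟨1, fun ⟨f, C, _, _, _, _, ⟨g, D, h5, _⟩, h6⟩ => ?_⟩
      have := h6 0 _ (h5 0)
      simp only [Equiv.Perm.one_apply] at this
      omega
    exact Nat.card_pos
  exact (pow_le_one₀ hy.le hy1.le).trans (by exact_mod_cast h)

theorem layAvoid_le_succ {a b : ℕ} {l : List ℕ} (ha : 0 < a) (hb : 0 < b) (n : ℕ) :
    layAvoid n (a :: b :: l) ≤ layAvoid (n + 1) (a :: b :: l) := by
  let e : Option (Fin n) ≃ Fin (n + 1) := (finSuccEquivLast (n := n)).symm
  have e1 : ∀ i : Fin n, ((e (some i) : Fin (n + 1)) : ℕ) = i := fun i => by simp [e]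
  have e2 : ((e none : Fin (n + 1)) : ℕ) = n := by simp [e]
  let Φ : Equiv.Perm (Fin n) → Equiv.Perm (Fin (n + 1)) := fun p => e.permCongr p.optionCongr
  have hΦ : ∀ p o, Φ p (e o) = e (p.optionCongr o) := fun p o => by simp [Φ, Equiv.permCongr_apply]
  refine Nat.card_le_card_of_injective (fun p => ⟨Φ p.1, fun h => p.2 ?_⟩) ?_
  · have h' := h.preimage e (by simp)
    simp only [hΦ] at h'
    obtain ⟨t, ht⟩ := HasLayers.exists_block (blk := fun o => if o = none then 1 else 0) ha hb
      (fun i _ j _ hij => by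
        rcases i with _ | i <;> rcases j with _ | j <;> simp only [e1, e2] at hij ⊢ <;>
          first | omega | simp)
      (fun i _ j _ hij => by
        rcases i with _ | i <;> rcases j with _ | j <;>
          simp only [e1, e2, Equiv.optionCongr_apply, Option.map_some, Option.map_none] at hij ⊢ <;>
          first | omega | simp) h'
    by_cases h1 : t = 1
    · obtain ⟨f, C, h2, -, -, h3, h4, h5⟩ := ht
      obtain ⟨c, hc⟩ := h4.nonempty hb
      have h6 := (h2 ⟨0, ha⟩).2
      have h7 := (h3 hc).2
      have h8 := (h5 ⟨0, ha⟩ c hc).1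
      simp only [h1, ite_eq_left_iff, zero_ne_one, imp_false, not_not] at h6 h7
      rw [h6, h7] at h8
      exact absurd h8 (lt_irrefl _)
    · have h2 := (ht.preimage some ?_).mono (Set.subset_univ _)
      · simpa only [Equiv.optionCongr_apply, Option.map_some, e1] using h2
      rintro (_ | i) ⟨-, hi⟩
      · exact absurd hi.symm h1
      · exact ⟨i, rfl⟩
  · intro p p' h
    have h1 := e.permCongr.injective (Subtype.ext_iff.1 h)
    exact Subtype.ext (Equiv.optionCongr_injective h1)

namespace LabelGrowth

/-- The label carried by a column that enters with label `a`: from row `lo` on, it decreases by one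
each time it meets a row with the same label. -/
def colLab (lo a : ℕ) (S : ℕ → ℕ) : ℕ → ℕ
  | 0 => a
  | y + 1 => if lo ≤ y ∧ S y = colLab lo a S y then colLab lo a S y - 1 else colLab lo a S y

/-- The labels of the rows once the first `k` columns have been processed. -/
def rowLab (b α β : ℕ → ℕ) : ℕ → ℕ → ℕ
  | 0 => β
  | k + 1 => fun y =>
    if b k ≤ y ∧ rowLab b α β k y = colLab (b k) (α k) (rowLab b α β k) y
    then rowLab b α β k y - 1 else rowLab b α β k y

/-- The label with which column `k` arrives at row `y`. -/
def colAt (b α β : ℕ → ℕ) (k y : ℕ) : ℕ := colLab (b k) (α k) (rowLab b α β k) y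

/-- Column `k` and row `y` meet with the common label `t`. -/
def Hit (b α β : ℕ → ℕ) (t k y : ℕ) : Prop :=
  b k ≤ y ∧ rowLab b α β k y = t ∧ colAt b α β k y = t

variable {b α β : ℕ → ℕ}

theorem colAt_zero (k : ℕ) : colAt b α β k 0 = α k := rfl

theorem colAt_succ (k y : ℕ) : colAt b α β k (y + 1) =
    if b k ≤ y ∧ rowLab b α β k y = colAt b α β k y then colAt b α β k y - 1
    else colAt b α β k y := rfl

theorem rowLab_succ (k y : ℕ) : rowLab b α β (k + 1) y =
    if b k ≤ y ∧ rowLab b α β k y = colAt b α β k y then rowLab b α β k y - 1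
    else rowLab b α β k y := rfl

theorem colAt_anti (k : ℕ) : Antitone (colAt b α β k) := antitone_nat_of_succ_le fun y => by
  rw [colAt_succ]; split_ifs <;> omega

theorem rowLab_anti (y : ℕ) : Antitone fun k => rowLab b α β k y := antitone_nat_of_succ_le fun k => by
  rw [rowLab_succ]; split_ifs <;> omega

theorem colAt_of_le {k y : ℕ} (hy : y ≤ b k) : colAt b α β k y = α k := by
  induction y with
  | zero => rfl
  | succ y ih => rw [colAt_succ, if_neg (by omega), ih (by omega)]

theorem exists_hit_col {k y₁ y₂ t : ℕ} (hy : y₁ ≤ y₂) (h1 : t < colAt b α β k y₁)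
    (h2 : colAt b α β k y₂ ≤ t) : ∃ y, y₁ ≤ y ∧ y < y₂ ∧ Hit b α β (t + 1) k y := by
  induction y₂, hy using Nat.le_induction with
  | base => omega
  | succ y hy ih =>
    by_cases h : colAt b α β k y ≤ t
    · obtain ⟨y', h3, h4, h5⟩ := ih h
      exact ⟨y', h3, by omega, h5⟩
    · rw [colAt_succ] at h2
      split_ifs at h2 with h3
      · exact ⟨y, hy, by omega, h3.1, by omega, by omega⟩
      · omega

theorem exists_hit_row {k₁ k₂ y t : ℕ} (hk : k₁ ≤ k₂) (h1 : t < rowLab b α β k₁ y)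
    (h2 : rowLab b α β k₂ y ≤ t) : ∃ k, k₁ ≤ k ∧ k < k₂ ∧ Hit b α β (t + 1) k y := by
  induction k₂, hk using Nat.le_induction with
  | base => omega
  | succ k hk ih =>
    by_cases h : rowLab b α β k y ≤ t
    · obtain ⟨k', h3, h4, h5⟩ := ih h
      exact ⟨k', h3, by omega, h5⟩
    · rw [rowLab_succ] at h2
      split_ifs at h2 with h3
      · exact ⟨k, hk, by omega, h3.1, by omega, by omega⟩
      · omega

theorem exists_hit_between {t k₁ k₂ y₁ y₂ : ℕ} (ht : 1 ≤ t) (h1 : Hit b α β t k₁ y₁)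
    (h2 : Hit b α β t k₂ y₂) (hk : k₁ < k₂) (hy : y₂ < y₁) (hb : b k₁ ≤ y₂) :
    ∃ k y, k₁ ≤ k ∧ k < k₂ ∧ y₂ ≤ y ∧ y < y₁ ∧ Hit b α β (t + 1) k y := by
  by_cases hc : t < colAt b α β k₁ y₂
  · obtain ⟨y, h3, h4, h5⟩ := exists_hit_col hy.le hc h1.2.2.le
    exact ⟨k₁, y, le_rfl, hk, h3, h4, h5⟩
  by_cases hr : t < rowLab b α β k₁ y₂
  · obtain ⟨k, h3, h4, h5⟩ := exists_hit_row hk.le hr h2.2.1.le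
    exact ⟨k, y₂, h3, h4, le_rfl, hy, h5⟩
  have h3 := colAt_anti (b := b) (α := α) (β := β) k₁ hy.le
  have h4 := rowLab_anti (b := b) (α := α) (β := β) y₂ hk.le
  have h5 := colAt_anti (b := b) (α := α) (β := β) k₁ (Nat.succ_le_of_lt hy)
  have h6 := h1.2.2
  have h7 := h2.2.1
  simp only [Nat.succ_eq_add_one] at h4 h5
  rw [colAt_succ, if_pos ⟨hb, by omega⟩] at h5
  omega

theorem exists_hit_of_chain (hb : Antitone b) (j t : ℕ) (ht : 1 ≤ t) (f g : ℕ → ℕ)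
    (hf : ∀ i < j, f i < f (i + 1)) (hg : ∀ i < j, g (i + 1) < g i)
    (h : ∀ i ≤ j, Hit b α β t (f i) (g i)) (h0 : b (f 0) ≤ g j) :
    ∃ k y, Hit b α β (t + j) k y := by
  induction j generalizing t f g with
  | zero => exact ⟨_, _, h 0 le_rfl⟩
  | succ j ih =>
    have hfm : ∀ i ≤ j + 1, f 0 ≤ f i := by
      intro i hi
      induction i with
      | zero => rfl
      | succ i ih => exact (ih (by omega)).trans (hf i (by omega)).le
    have hgm : ∀ d ≤ j + 1, g (j + 1) ≤ g (j + 1 - d) := by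
      intro d hd
      induction d with
      | zero => rfl
      | succ d ih =>
        have := hg (j + 1 - (d + 1)) (by omega)
        rw [show j + 1 - (d + 1) + 1 = j + 1 - d by omega] at this
        exact (ih (by omega)).trans this.le
    have hstep : ∀ i, ∃ k y, i ≤ j → f i ≤ k ∧ k < f (i + 1) ∧ g (i + 1) ≤ y ∧ y < g i ∧
        Hit b α β (t + 1) k y := by
      intro i
      by_cases hi : i ≤ j
      · obtain ⟨k, y, H⟩ := exists_hit_between ht (h i (by omega)) (h (i + 1) (by omega))
          (hf i (by omega)) (hg i (by omega)) (by
            have h1 := hgm (j + 1 - (i + 1)) (by omega)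
            rw [show j + 1 - (j + 1 - (i + 1)) = i + 1 by omega] at h1
            exact (hb (hfm i (by omega))).trans (h0.trans h1))
        exact ⟨k, y, fun _ => H⟩
      · exact ⟨0, 0, fun h => absurd h hi⟩
    choose f' g' H using hstep
    obtain ⟨k, y, hky⟩ := ih (t + 1) (by omega) f' g'
      (fun i hi => by have := H i (by omega); have := H (i + 1) (by omega); omega)
      (fun i hi => by have := H i (by omega); have := H (i + 1) (by omega); omega)
      (fun i hi => (H i hi).2.2.2.2)
      ((hb (H 0 (by omega)).1).trans (h0.trans (H j le_rfl).2.2.1))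
    exact ⟨k, y, by rwa [show t + (j + 1) = t + 1 + j by ring]⟩

/-- The number of rows at height at least `y` and below `N` that carry label `t`. -/
def cntFrom (N : ℕ) (S : ℕ → ℕ) (y t : ℕ) : ℕ := ((Finset.Ico y N).filter fun i => S i = t).card

theorem cntFrom_self (N : ℕ) (S : ℕ → ℕ) (t : ℕ) : cntFrom N S N t = 0 := by simp [cntFrom]

theorem cntFrom_of_lt {N : ℕ} (S : ℕ → ℕ) {y : ℕ} (hy : y < N) (t : ℕ) :
    cntFrom N S y t = cntFrom N S (y + 1) t + if S y = t then 1 else 0 := by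
  unfold cntFrom
  rw [← Finset.insert_Ico_add_one_left_eq_Ico hy, Finset.filter_insert]
  split_ifs with h
  · rw [Finset.card_insert_of_notMem (by simp)]
  · rfl

/-- The number of columns before `k` that carry label `t`. -/
def cntBefore (α : ℕ → ℕ) (k t : ℕ) : ℕ := ((Finset.range k).filter fun i => α i = t).card

theorem cntBefore_succ (α : ℕ → ℕ) (k t : ℕ) :
    cntBefore α (k + 1) t = cntBefore α k t + if α k = t then 1 else 0 := by
  unfold cntBefore
  rw [Finset.range_add_one, Finset.filter_insert]
  split_ifs with h
  · rw [Finset.card_insert_of_notMem (by simp)]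
  · rfl

theorem cntFrom_rowLab_succ {N k : ℕ} (h0 : colAt b α β k N = 0) {y : ℕ} (hy : y ≤ N) {t : ℕ}
    (ht : 1 ≤ t) : cntFrom N (rowLab b α β (k + 1)) y t + (if colAt b α β k y = t then 1 else 0) =
      cntFrom N (rowLab b α β k) y t := by
  induction hy using Nat.decreasingInduction with
  | self => rw [cntFrom_self, cntFrom_self, h0, if_neg (by omega)]
  | of_succ y hy ih =>
    rw [cntFrom_of_lt _ hy, cntFrom_of_lt _ hy, rowLab_succ]
    rw [colAt_succ] at ih
    by_cases h : b k ≤ y ∧ rowLab b α β k y = colAt b α β k y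
    · rw [if_pos h] at ih ⊢
      rw [h.2]
      split_ifs at ih ⊢ <;> omega
    · rw [if_neg h] at ih ⊢
      omega

/-- The ballot condition along the boundary path `b`. -/
def Ballot (N : ℕ) (b α β : ℕ → ℕ) : Prop :=
  ∀ k ≤ N, ∀ y ≤ N, b k ≤ y → (∀ k' < k, y ≤ b k') → ∀ t, 1 ≤ t →
    cntFrom N β y (t + 1) + cntBefore α k t ≤ cntFrom N β y t + cntBefore α k (t + 1)

theorem cntFrom_colAt_lt {N k : ℕ}
    (hinv : ∀ y ≤ N, b k ≤ y → ∀ t, 1 ≤ t →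
      cntFrom N (rowLab b α β k) y (t + 1) ≤ cntFrom N (rowLab b α β k) y t)
    (hstart : cntFrom N (rowLab b α β k) (b k) (α k + 1) <
      cntFrom N (rowLab b α β k) (b k) (α k)) :
    ∀ y ≤ N, b k ≤ y → 1 ≤ colAt b α β k y →
      cntFrom N (rowLab b α β k) y (colAt b α β k y + 1) <
        cntFrom N (rowLab b α β k) y (colAt b α β k y) := by
  intro y hyN hy
  induction y, hy using Nat.le_induction with
  | base => intro _; rwa [colAt_of_le le_rfl]
  | succ y hy ih =>
    intro h1
    have hyN' : y < N := hyN
    have ih := ih (by omega) (h1.trans (colAt_anti k (Nat.le_succ y)))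
    rw [colAt_succ] at h1 ⊢
    rw [cntFrom_of_lt _ hyN', cntFrom_of_lt _ hyN'] at ih
    by_cases h : b k ≤ y ∧ rowLab b α β k y = colAt b α β k y
    · rw [if_pos h] at h1 ⊢
      have h2 := hinv y (by omega) hy (colAt b α β k y - 1) h1
      rw [cntFrom_of_lt _ hyN', cntFrom_of_lt _ hyN',
        show colAt b α β k y - 1 + 1 = colAt b α β k y by omega] at h2
      rw [show colAt b α β k y - 1 + 1 = colAt b α β k y by omega]
      rw [h.2] at h2
      rw [if_pos rfl, if_neg (by omega)] at h2
      omega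
    · rw [if_neg h] at h1 ⊢
      rw [if_neg (show ¬ rowLab b α β k y = colAt b α β k y by tauto)] at ih
      omega

theorem invariant {N : ℕ} (hb : Antitone b) (hbN : b 0 ≤ N) (hα : ∀ k < N, 1 ≤ α k)
    (H : Ballot N b α β) (k : ℕ) (hk : k ≤ N) :
    (∀ y ≤ N, b k ≤ y → ∀ t, 1 ≤ t →
      cntFrom N (rowLab b α β k) y (t + 1) ≤ cntFrom N (rowLab b α β k) y t) ∧
    (∀ y ≤ N, (∀ k' < k, y ≤ b k') → ∀ t, 1 ≤ t →
      cntFrom N (rowLab b α β k) y t + cntBefore α k t = cntFrom N β y t) ∧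
    ∀ k' < k, colAt b α β k' N = 0 := by
  induction k with
  | zero =>
    refine ⟨fun y hy hby t ht => ?_, fun y hy _ t ht => ?_, by simp⟩
    · simpa [cntBefore, rowLab] using H 0 hk y hy hby (by simp) t ht
    · simp [cntBefore, rowLab]
  | succ k ih =>
    obtain ⟨h1, h2, h3⟩ := ih (by omega)
    have hbk : b k ≤ N := (hb (Nat.zero_le k)).trans hbN
    have hstart : cntFrom N (rowLab b α β k) (b k) (α k + 1) <
        cntFrom N (rowLab b α β k) (b k) (α k) := by
      have e1 := h2 (b k) hbk (fun k' hk' => hb hk'.le) (α k) (hα k hk)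
      have e2 := h2 (b k) hbk (fun k' hk' => hb hk'.le) (α k + 1) (by omega)
      have e3 := H (k + 1) hk (b k) hbk (hb (Nat.le_succ k)) (fun k' hk' => hb (by omega))
        (α k) (hα k hk)
      rw [cntBefore_succ, cntBefore_succ, if_pos rfl, if_neg (by omega)] at e3
      omega
    have hQ := cntFrom_colAt_lt h1 hstart
    have h0 : colAt b α β k N = 0 := by
      by_contra h
      have := hQ N le_rfl hbk (by omega)
      rw [cntFrom_self, cntFrom_self] at this
      omega
    have hform : ∀ y ≤ N, (∀ k' < k + 1, y ≤ b k') → ∀ t, 1 ≤ t →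
        cntFrom N (rowLab b α β (k + 1)) y t + cntBefore α (k + 1) t = cntFrom N β y t := by
      intro y hy hyb t ht
      have e1 := h2 y hy (fun k' hk' => hyb k' (by omega)) t ht
      have e2 := cntFrom_rowLab_succ h0 hy ht
      rw [colAt_of_le (hyb k (by omega))] at e2
      rw [cntBefore_succ]
      omega
    refine ⟨fun y hy hby t ht => ?_, hform, fun k' hk' => ?_⟩
    · rcases le_total y (b k) with hyb | hyb
      · have hyb' : ∀ k' < k + 1, y ≤ b k' := fun k' hk' => hyb.trans (hb (by omega))
        have e1 := hform y hy hyb' t ht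
        have e2 := hform y hy hyb' (t + 1) (by omega)
        have e3 := H (k + 1) hk y hy hby hyb' t ht
        omega
      · have e1 := cntFrom_rowLab_succ h0 hy ht
        have e2 := cntFrom_rowLab_succ h0 hy (show 1 ≤ t + 1 by omega)
        have e3 := h1 y hy hyb t ht
        have e4 := hQ y hy hyb
        by_cases h : colAt b α β k y = t
        · rw [h] at e4
          have := e4 ht
          rw [if_pos h] at e1
          omega
        · rw [if_neg h] at e1
          omega
    · rcases Nat.lt_succ_iff_lt_or_eq.1 hk' with h | rfl
      · exact h3 k' h
      · exact h0

theorem exists_perm {N : ℕ} (h0 : ∀ k < N, colAt b α β k N = 0) (hα : ∀ k < N, 1 ≤ α k) :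
    ∃ π : Equiv.Perm (Fin N), ∀ k : Fin N, Hit b α β 1 k (π k) := by
  have h : ∀ k : Fin N, ∃ y : Fin N, Hit b α β 1 k y := by
    intro k
    obtain ⟨y, -, h1, h2⟩ := exists_hit_col (b := b) (α := α) (β := β) (k := k) (t := 0)
      (Nat.zero_le N) (by rw [colAt_zero]; exact hα k k.2) (h0 k k.2).le
    exact ⟨⟨y, h1⟩, h2⟩
  choose f hf using h
  have key : ∀ k k' : Fin N, k < k' → f k ≠ f k' := by
    intro k k' hkk e
    have h1 := (hf k').2.1
    have h2 := rowLab_anti (b := b) (α := α) (β := β) (f k' : ℕ) (Nat.succ_le_of_lt hkk)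
    have h3 := hf k
    simp only [Nat.succ_eq_add_one] at h2
    rw [e] at h3
    rw [rowLab_succ, if_pos ⟨h3.1, h3.2.1.trans h3.2.2.symm⟩, h3.2.1, h1] at h2
    omega
  have hinj : Function.Injective f := by
    intro k k' e
    by_contra hne
    rcases lt_or_gt_of_ne hne with h | h
    · exact key _ _ h e
    · exact key _ _ h e.symm
  exact ⟨Equiv.ofBijective f (Finite.injective_iff_bijective.1 hinj), hf⟩

/-- At most one row meets a given column with label `1`. -/
theorem Hit.unique {k y y' : ℕ} (h : Hit b α β 1 k y) (h' : Hit b α β 1 k y') : y = y' := by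
  have key : ∀ y y' : ℕ, Hit b α β 1 k y → Hit b α β 1 k y' → ¬ y < y' := by
    intro y y' h h' hlt
    have h2 := colAt_anti (b := b) (α := α) (β := β) k (Nat.succ_le_of_lt hlt)
    simp only [Nat.succ_eq_add_one] at h2
    rw [colAt_succ, if_pos ⟨h.1, h.2.1.trans h.2.2.symm⟩, h.2.2, h'.2.2] at h2
    omega
  have := key _ _ h h'
  have := key _ _ h' h
  omega

theorem labels_eq {N : ℕ} {α' β' : ℕ → ℕ} {π : Equiv.Perm (Fin N)}
    (h0 : ∀ k < N, colAt b α β k N = 0) (h0' : ∀ k < N, colAt b α' β' k N = 0)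
    (h : ∀ k : Fin N, Hit b α β 1 k (π k)) (h' : ∀ k : Fin N, Hit b α' β' 1 k (π k)) :
    (∀ k < N, α k = α' k) ∧ ∀ y < N, β y = β' y := by
  have hzero : ∀ {α β : ℕ → ℕ}, (∀ k : Fin N, Hit b α β 1 k (π k)) →
      ∀ y < N, rowLab b α β N y = 0 := by
    intro α β h y hy
    obtain ⟨k, hk⟩ := π.surjective ⟨y, hy⟩
    have h1 := h k
    rw [hk] at h1
    have h2 := rowLab_anti (b := b) (α := α) (β := β) y (Nat.succ_le_of_lt k.2)
    simp only [Nat.succ_eq_add_one] at h2 h1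
    rw [rowLab_succ, if_pos ⟨h1.1, h1.2.1.trans h1.2.2.symm⟩, h1.2.1] at h2
    omega
  have hcell : ∀ k < N, ∀ y < N, colAt b α β k (y + 1) = colAt b α' β' k (y + 1) →
      rowLab b α β (k + 1) y = rowLab b α' β' (k + 1) y →
      colAt b α β k y = colAt b α' β' k y ∧ rowLab b α β k y = rowLab b α' β' k y := by
    intro k hk y hy e1 e2
    have hh : Hit b α β 1 k y ↔ Hit b α' β' 1 k y := by
      have a1 := h ⟨k, hk⟩
      have a2 := h' ⟨k, hk⟩
      constructor
      · intro a
        rwa [← a1.unique a]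
      · intro a
        rwa [← a2.unique a]
    rw [colAt_succ, colAt_succ] at e1
    rw [rowLab_succ, rowLab_succ] at e2
    unfold Hit at hh
    by_cases hb : b k ≤ y
    · simp only [hb, true_and] at e1 e2 hh
      split_ifs at e1 e2 <;> omega
    · simp only [hb, false_and, if_false] at e1 e2
      exact ⟨e1, e2⟩
  have hcol : ∀ k < N, (∀ y < N, rowLab b α β (k + 1) y = rowLab b α' β' (k + 1) y) →
      ∀ y ≤ N, colAt b α β k y = colAt b α' β' k y := by
    intro k hk hrow y hy
    induction hy using Nat.decreasingInduction with
    | self => rw [h0 k hk, h0' k hk]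
    | of_succ y hy ih => exact (hcell k hk y hy ih (hrow y hy)).1
  have hrow : ∀ k ≤ N, ∀ y < N, rowLab b α β k y = rowLab b α' β' k y := by
    intro k hk
    induction hk using Nat.decreasingInduction with
    | self => intro y hy; rw [hzero h y hy, hzero h' y hy]
    | of_succ k hk ih =>
      intro y hy
      exact (hcell k hk y hy (hcol k hk ih _ hy) (ih y hy)).2
  exact ⟨fun k hk => hcol k hk (hrow (k + 1) hk) 0 (Nat.zero_le _),
    fun y hy => hrow 0 (Nat.zero_le _) y hy⟩

end LabelGrowth

/-- There are at least `D ^ T` permutations of length `(T + K + 2) * c` all of whose points lie in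
`F`, and in which no copy of the layered pattern `v` has its bounding box in `F`, for every
staircase `F` that stays close to the diagonal. -/
def Gadget (v : List ℕ) (c D K : ℕ) : Prop :=
  ∀ (T : ℕ) (F : ℕ → ℕ → Prop), (∀ k k' r r', k ≤ k' → r' ≤ r → F k r → F k' r') →
    (∀ k r, r < k + K * c → r < (T + K + 2) * c → F k r) →
    (∀ k r, F k r → r < k + (K + 3) * c) →
    D ^ T ≤ Nat.card {π : Equiv.Perm (Fin ((T + K + 2) * c)) //
      (∀ k : Fin ((T + K + 2) * c), F k (π k)) ∧
      ¬ ∃ C : Set (Fin ((T + K + 2) * c)),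
        HasLayers (fun i : Fin ((T + K + 2) * c) => (i : ℕ)) (fun i => (π i : ℕ)) v C ∧
          ∀ k ∈ C, ∀ k' ∈ C, F k (π k')}

/-- The number of fillings supplied by gadgets for `v` grows like `y ^ (2 * c)` per `c` columns, for
every `y < x`. -/
def GadgetGrows (v : List ℕ) (x : ℝ) : Prop :=
  ∀ y : ℝ, 0 < y → y < x → ∃ δ : ℝ, 0 < δ ∧ ∀ c : ℕ, ∃ D K : ℕ,
    δ * y ^ (2 * c) ≤ D ∧ Gadget v c D K

namespace LabelGrowth

theorem cntBefore_mono (w : ℕ → ℕ) (t : ℕ) : Monotone fun j => cntBefore w j t :=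
  monotone_nat_of_le_succ fun j => by
    rw [cntBefore_succ]
    omega

theorem cntBefore_add_le (w : ℕ → ℕ) (j i t : ℕ) :
    cntBefore w (j + i) t ≤ cntBefore w j t + i := by
  induction i with
  | zero => rfl
  | succ i ih =>
    rw [← add_assoc, cntBefore_succ]
    split_ifs <;> omega

theorem cntBefore_congr {w w' : ℕ → ℕ} {j : ℕ} (h : ∀ i < j, w i = w' i) (t : ℕ) :
    cntBefore w j t = cntBefore w' j t := by
  induction j with
  | zero => rfl
  | succ j ih => rw [cntBefore_succ, cntBefore_succ, ih fun i hi => h i (by omega), h j (by omega)]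

theorem cntBefore_add (w : ℕ → ℕ) (j i t : ℕ) :
    cntBefore w (j + i) t = cntBefore w j t + cntBefore (fun m => w (j + m)) i t := by
  induction i with
  | zero => rfl
  | succ i ih => rw [← add_assoc, cntBefore_succ, cntBefore_succ, ih, add_assoc]

theorem cntBefore_eq_zero {w : ℕ → ℕ} {j t : ℕ} (h : ∀ i < j, w i ≠ t) : cntBefore w j t = 0 := by
  induction j with
  | zero => rfl
  | succ j ih => rw [cntBefore_succ, ih fun i hi => h i (by omega), if_neg (h j (by omega))]

theorem cntFrom_rev {N : ℕ} (ρ : ℕ → ℕ) {y : ℕ} (hy : y ≤ N) (t : ℕ) :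
    cntFrom N (fun i => ρ (N - 1 - i)) y t = cntBefore ρ (N - y) t := by
  induction hy using Nat.decreasingInduction with
  | self => rw [cntFrom_self, Nat.sub_self]; rfl
  | of_succ y hy ih =>
    rw [cntFrom_of_lt _ hy, ih, show N - y = N - (y + 1) + 1 by omega, cntBefore_succ,
      show N - 1 - y = N - (y + 1) by omega]

/-- A word over `1, …, s - 1` all of whose prefixes are ballot sequences, with large gaps between
the numbers of occurrences of consecutive letters. -/
theorem exists_buffer (s g : ℕ) : ∃ (w : ℕ → ℕ) (K : ℕ), (∀ i, w i < s ∨ w i ≤ 1) ∧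
    (∀ i < K * g, 1 ≤ w i) ∧
    (∀ j ≤ K * g, ∀ t, 1 ≤ t → cntBefore w j (t + 1) ≤ cntBefore w j t) ∧
    ∀ t, 1 ≤ t → t < s → cntBefore w (K * g) (t + 1) + g ≤ cntBefore w (K * g) t := by
  set P : ℕ → ℕ := fun t => ∑ i ∈ Finset.range t, (s - 1 - i) * g with hP
  have hPs : ∀ t, P (t + 1) = P t + (s - 1 - t) * g := fun t => Finset.sum_range_succ _ _
  have hPm : Monotone P := monotone_nat_of_le_succ fun t => by rw [hPs]; omega
  have hP0 : P 0 = 0 := rfl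
  have hL : P (s - 1) = (∑ i ∈ Finset.range (s - 1), (s - 1 - i)) * g := by
    rw [hP, Finset.sum_mul]
  have hw : ∀ i, ∃ t, 1 ≤ t ∧ (t < s ∨ t ≤ 1) ∧ (i < P (s - 1) → P (t - 1) ≤ i ∧ i < P t) := by
    intro i
    by_cases hi : i < P (s - 1)
    · classical
      have hex : ∃ t, i < P t := ⟨_, hi⟩
      have h1 := Nat.find_spec hex
      have h2 : Nat.find hex ≠ 0 := fun h0 => by rw [h0, hP0] at h1; omega
      have h3 := Nat.find_min' hex hi
      exact ⟨Nat.find hex, by omega, by omega, fun _ =>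
        ⟨not_lt.1 (Nat.find_min hex (by omega)), h1⟩⟩
    · exact ⟨1, le_rfl, Or.inr le_rfl, fun h => absurd h hi⟩
  choose w hw1 hw2 hw3 using hw
  have hcnt : ∀ j ≤ P (s - 1), ∀ t, cntBefore w j (t + 1) + min j (P t) = min j (P (t + 1)) := by
    intro j hj t
    induction j with
    | zero => simp [cntBefore]
    | succ j ih =>
      have ih := ih (by omega)
      obtain ⟨h1, h2⟩ := hw3 j (by omega)
      have h3 := hw1 j
      rw [cntBefore_succ]
      have h4 := hPm (Nat.le_succ t)
      simp only [Nat.succ_eq_add_one] at h4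
      by_cases h : w j = t + 1
      · rw [h] at h1 h2
        rw [if_pos h]
        simp only [Nat.add_sub_cancel] at h1
        omega
      · rw [if_neg h]
        rcases lt_or_gt_of_ne h with h5 | h5
        · have := hPm (show w j ≤ t by omega)
          omega
        · have := hPm (show t + 1 ≤ w j - 1 by omega)
          omega
  refine ⟨w, ∑ i ∈ Finset.range (s - 1), (s - 1 - i), hw2, fun i _ => hw1 i, ?_, ?_⟩
  · rw [← hL]
    intro j hj t ht
    obtain ⟨t, rfl⟩ : ∃ t', t = t' + 1 := ⟨t - 1, by omega⟩
    have h1 := hcnt j hj t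
    have h2 := hcnt j hj (t + 1)
    have h3 := hPs t
    have h4 := hPs (t + 1)
    have h5 : (s - 1 - (t + 1)) * g ≤ (s - 1 - t) * g := Nat.mul_le_mul_right _ (by omega)
    omega
  · rw [← hL]
    intro t ht hts
    obtain ⟨t, rfl⟩ : ∃ t', t = t' + 1 := ⟨t - 1, by omega⟩
    have h1 := hcnt _ le_rfl t
    have h2 := hcnt _ le_rfl (t + 1)
    have h3 := hPs t
    have h4 := hPs (t + 1)
    have h5 : (s - 1 - (t + 1)) * g + g = (s - 1 - t) * g := by
      rw [show s - 1 - t = s - 1 - (t + 1) + 1 by omega]; ring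
    have h6 := hPm (show t + 1 ≤ s - 1 by omega)
    have h7 : P (t + 1 + 1) ≤ P (s - 1) := by
      rcases Nat.lt_or_ge (t + 1) (s - 1) with h | h
      · exact hPm h
      · rw [hPs, show s - 1 - (t + 1) = 0 by omega, zero_mul, add_zero]; exact h6
    omega

/-- The concatenation of the words `A 0, A 1, …` of length `c`. -/
def concat (c : ℕ) (A : ℕ → ℕ → ℕ) (m : ℕ) : ℕ := A (m / c) (m % c)

theorem cntBefore_concat_mul {c q t κ : ℕ} {A : ℕ → ℕ → ℕ}
    (h : ∀ i < q, cntBefore (A i) c t = κ) : cntBefore (concat c A) (q * c) t = κ * q := by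
  induction q with
  | zero => simp [cntBefore]
  | succ q ih =>
    rw [Nat.succ_mul, cntBefore_add, ih fun i hi => h i (by omega), mul_add, mul_one,
      ← h q (by omega)]
    congr 1
    refine cntBefore_congr (fun i hi => ?_) t
    rw [concat, mul_comm q, Nat.mul_add_div (by omega), Nat.div_eq_of_lt hi, add_zero,
      Nat.mul_add_mod, Nat.mod_eq_of_lt hi]

theorem cntBefore_concat_bounds {c T t κ m : ℕ} {A : ℕ → ℕ → ℕ} (hc : 0 < c)
    (h : ∀ i < T, cntBefore (A i) c t = κ) (hm : m ≤ T * c) :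
    κ * (m / c) ≤ cntBefore (concat c A) m t ∧ cntBefore (concat c A) m t ≤ κ * (m / c) + c := by
  have hq : m / c ≤ T := by
    rw [mul_comm] at hm
    exact Nat.div_le_of_le_mul hm
  have h1 := cntBefore_concat_mul (q := m / c) fun i hi => h i (by omega)
  have h2 := Nat.div_add_mod m c
  have h3 := Nat.mod_lt m hc
  rw [mul_comm] at h2
  constructor
  · rw [← h1]
    exact cntBefore_mono _ t (Nat.div_mul_le_self m c)
  · have h4 := cntBefore_add_le (concat c A) (m / c * c) (m % c) t
    rw [h2, h1] at h4
    omega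

/-- A buffer word followed by data words. -/
def rowWord (L c : ℕ) (w : ℕ → ℕ) (B : ℕ → ℕ → ℕ) (r : ℕ) : ℕ :=
  if r < L then w r else concat c B (r - L)

/-- Data words followed by a reversed buffer word. -/
def colWord (M N c : ℕ) (w : ℕ → ℕ) (A : ℕ → ℕ → ℕ) (k : ℕ) : ℕ :=
  if k < M then concat c A k else w (N - 1 - k)

theorem cntBefore_rowWord_le {L c : ℕ} {w : ℕ → ℕ} {B : ℕ → ℕ → ℕ} {a : ℕ} (ha : a ≤ L) (t : ℕ) :
    cntBefore (rowWord L c w B) a t = cntBefore w a t :=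
  cntBefore_congr (fun i hi => if_pos (by omega)) t

theorem cntBefore_rowWord_add {L c : ℕ} {w : ℕ → ℕ} {B : ℕ → ℕ → ℕ} (m t : ℕ) :
    cntBefore (rowWord L c w B) (L + m) t = cntBefore w L t + cntBefore (concat c B) m t := by
  rw [cntBefore_add, cntBefore_rowWord_le le_rfl]
  congr 1
  refine cntBefore_congr (fun i _ => ?_) t
  rw [rowWord, if_neg (by omega), Nat.add_sub_cancel_left]

theorem cntBefore_colWord_le {M N c : ℕ} {w : ℕ → ℕ} {A : ℕ → ℕ → ℕ} {k : ℕ} (hk : k ≤ M) (t : ℕ) :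
    cntBefore (colWord M N c w A) k t = cntBefore (concat c A) k t :=
  cntBefore_congr (fun i hi => if_pos (by omega)) t

theorem cntBefore_colWord_add {M L c : ℕ} {w : ℕ → ℕ} {A : ℕ → ℕ → ℕ} {k : ℕ} (hk : k ≤ L) (t : ℕ) :
    cntBefore (colWord M (M + L) c w A) (M + k) t + cntBefore w (L - k) t =
      cntBefore (concat c A) M t + cntBefore w L t := by
  induction k with
  | zero => rw [add_zero, cntBefore_colWord_le le_rfl, Nat.sub_zero]
  | succ k ih =>
    have ih := ih (by omega)
    have e : colWord M (M + L) c w A (M + k) = w (L - (k + 1)) := by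
      rw [colWord, if_neg (by omega)]
      congr 1
      omega
    rw [← add_assoc, cntBefore_succ, e]
    rw [show L - k = L - (k + 1) + 1 by omega, cntBefore_succ] at ih
    omega

theorem ballot_of_window {T L c s : ℕ} {b w : ℕ → ℕ} {A B : ℕ → ℕ → ℕ} {κ : ℕ → ℕ}
    (hκ : ∀ t, κ t ≤ c)
    (hA : ∀ i < T, ∀ t, cntBefore (A i) c t = κ t) (hB : ∀ i < T, ∀ t, cntBefore (B i) c t = κ t)
    (hw1 : ∀ j ≤ L, ∀ t, 1 ≤ t → cntBefore w j (t + 1) ≤ cntBefore w j t)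
    (hw2 : ∀ t, 1 ≤ t → t < s → cntBefore w L (t + 1) + 6 * c ≤ cntBefore w L t)
    (hws : ∀ i < L, w i < s) (hκs : ∀ t, s ≤ t → κ t = 0)
    (hlow : ∀ k y, y ≤ b k → y = 0 ∨ k + L + y ≤ T * c + L)
    (hup : ∀ k y, b k ≤ y → T * c ≤ k + y + 3 * c) :
    Ballot (T * c + L) b (colWord (T * c) (T * c + L) c w A)
      (fun y => rowWord L c w B (T * c + L - 1 - y)) := by
  intro k hk y hy hby hyb t ht
  rw [cntFrom_rev _ hy, cntFrom_rev _ hy]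
  have hu := hup k y hby
  have hl : k = 0 ∨ y = 0 ∨ k - 1 + L + y ≤ T * c + L := by
    rcases Nat.eq_zero_or_pos k with h | h
    · exact Or.inl h
    · exact Or.inr (hlow (k - 1) y (hyb _ (by omega)))
  rcases Nat.lt_or_ge (T * c) k with hkT | hkT
  · obtain ⟨k, rfl⟩ := Nat.exists_eq_add_of_lt hkT
    obtain rfl : y = 0 := by omega
    have e1 := cntBefore_colWord_add (M := T * c) (c := c) (w := w) (A := A)
      (show k + 1 ≤ L by omega) t
    have e2 := cntBefore_colWord_add (M := T * c) (c := c) (w := w) (A := A)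
      (show k + 1 ≤ L by omega) (t + 1)
    rw [cntBefore_concat_mul fun i hi => hA i hi _] at e1 e2
    rw [Nat.sub_zero, add_comm (T * c) L, cntBefore_rowWord_add, cntBefore_rowWord_add,
      cntBefore_concat_mul fun i hi => hB i hi _, cntBefore_concat_mul fun i hi => hB i hi _,
      add_comm L (T * c), add_assoc (T * c) k 1]
    have := hw1 (L - (k + 1)) (by omega) t ht
    omega
  rw [cntBefore_colWord_le hkT, cntBefore_colWord_le hkT]
  rcases Nat.lt_or_ge (T * c + L - y) L with ha | ha
  · obtain rfl : k = 0 := by omega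
    rw [cntBefore_rowWord_le ha.le, cntBefore_rowWord_le ha.le]
    simpa [cntBefore] using hw1 _ ha.le t ht
  obtain ⟨m, hm⟩ := Nat.exists_eq_add_of_le ha
  rw [hm, cntBefore_rowWord_add, cntBefore_rowWord_add]
  rcases Nat.eq_zero_or_pos c with rfl | hc
  · obtain rfl : m = 0 := by omega
    obtain rfl : k = 0 := by omega
    simpa [cntBefore] using hw1 L le_rfl t ht
  have hmT : m ≤ T * c := by omega
  have a1 := cntBefore_concat_bounds hc (fun i hi => hA i hi t) hkT
  have a2 := cntBefore_concat_bounds hc (fun i hi => hA i hi (t + 1)) hkT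
  have b1 := cntBefore_concat_bounds hc (fun i hi => hB i hi t) hmT
  have b2 := cntBefore_concat_bounds hc (fun i hi => hB i hi (t + 1)) hmT
  have q1 : k / c ≤ m / c + 1 := by
    rw [← Nat.add_div_right _ hc]
    exact Nat.div_le_div_right (by omega)
  have q2 : m / c ≤ k / c + 3 := by
    rw [← Nat.add_mul_div_right _ _ hc]
    exact Nat.div_le_div_right (by omega)
  rcases Nat.lt_or_ge t s with hts | hts
  · have h1 := hw2 t ht hts
    have c1 := Nat.mul_le_mul_left (κ t) q1
    have c2 := Nat.mul_le_mul_left (κ (t + 1)) q2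
    rw [mul_add] at c1 c2
    have := hκ t
    have := hκ (t + 1)
    omega
  · have z1 : ∀ i < T, ∀ t', s ≤ t' → ∀ j < c, A i j ≠ t' ∧ B i j ≠ t' := by
      intro i hi t' ht' j hj
      have e1 := hA i hi t'
      have e2 := hB i hi t'
      rw [hκs t' ht', cntBefore, Finset.card_eq_zero, Finset.filter_eq_empty_iff] at e1 e2
      exact ⟨e1 (Finset.mem_range.2 hj), e2 (Finset.mem_range.2 hj)⟩
    have hdiv : ∀ i < T * c, i / c < T := fun i hi => by
      rw [mul_comm] at hi
      exact Nat.div_lt_of_lt_mul hi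
    rw [cntBefore_eq_zero (w := concat c B) fun i hi =>
        (z1 _ (hdiv i (by omega)) (t + 1) (by omega) _ (Nat.mod_lt _ hc)).2,
      cntBefore_eq_zero (w := concat c A) fun i hi =>
        (z1 _ (hdiv i (by omega)) t hts _ (Nat.mod_lt _ hc)).1,
      cntBefore_eq_zero (w := w) (t := t + 1) fun i hi => by have := hws i hi; omega]
    omega

end LabelGrowth

namespace LabelGrowth

/-- A word over `Fin (s - 1)`, as a sequence of labels in `1, …, s - 1`. -/
def letters {c s : ℕ} (u : Fin c → Fin (s - 1)) (j : ℕ) : ℕ :=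
  if h : j < c then u ⟨j, h⟩ + 1 else 1

theorem one_le_letters {c s : ℕ} (u : Fin c → Fin (s - 1)) (j : ℕ) : 1 ≤ letters u j := by
  unfold letters; split_ifs <;> omega

theorem letters_lt {c s : ℕ} (hs : 2 ≤ s) (u : Fin c → Fin (s - 1)) (j : ℕ) : letters u j < s := by
  unfold letters; split_ifs <;> omega

/-- A sequence of words, extended by constant words. -/
def extend {c s T : ℕ} (A : Fin T → Fin c → Fin (s - 1)) (i : ℕ) : ℕ → ℕ :=
  if h : i < T then letters (A ⟨i, h⟩) else fun _ => 1

theorem one_le_extend {c s T : ℕ} (A : Fin T → Fin c → Fin (s - 1)) (i j : ℕ) :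
    1 ≤ extend A i j := by
  unfold extend; split_ifs
  · exact one_le_letters _ _
  · rfl

theorem extend_lt {c s T : ℕ} (hs : 2 ≤ s) (A : Fin T → Fin c → Fin (s - 1)) (i j : ℕ) :
    extend A i j < s := by
  unfold extend; split_ifs
  · exact letters_lt hs _ _
  · exact hs

theorem eq_of_concat_extend_eq {c s T : ℕ} {A A' : Fin T → Fin c → Fin (s - 1)}
    (h : ∀ m < T * c, concat c (extend A) m = concat c (extend A') m) : A = A' := by
  funext i j
  have hm : (i : ℕ) * c + j < T * c := by
    have := Nat.mul_le_mul_right c (Nat.succ_le_of_lt i.2)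
    have := Nat.succ_mul (i : ℕ) c
    omega
  have h1 := h _ hm
  have hc : 0 < c := j.pos
  rw [concat, concat, mul_comm (i : ℕ), Nat.mul_add_div hc, Nat.div_eq_of_lt j.2, add_zero,
    Nat.mul_add_mod, Nat.mod_eq_of_lt j.2] at h1
  simpa [extend, letters, Fin.ext_iff] using h1

theorem card_pow_le {T L N c s : ℕ} (hs : 2 ≤ s) (hN : N = T * c + L)
    {W : Finset (Fin c → Fin (s - 1))} (hWn : W.Nonempty) {κ : ℕ → ℕ}
    (hW : ∀ u ∈ W, ∀ t, cntBefore (letters u) c t = κ t) {w : ℕ → ℕ} (hw0 : ∀ i, w i < s)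
    (hw1 : ∀ i < L, 1 ≤ w i)
    (hw2 : ∀ j ≤ L, ∀ t, 1 ≤ t → cntBefore w j (t + 1) ≤ cntBefore w j t)
    (hw3 : ∀ t, 1 ≤ t → t < s → cntBefore w L (t + 1) + 6 * c ≤ cntBefore w L t)
    {F : ℕ → ℕ → Prop} (hF : ∀ k k' r r', k ≤ k' → r' ≤ r → F k r → F k' r')
    (hlow : ∀ k r, r < k + L → r < N → F k r) (hup : ∀ k r, F k r → r < k + L + 3 * c) :
    (W.card ^ 2) ^ T ≤ Nat.card {π : Equiv.Perm (Fin N) // (∀ k : Fin N, F k (π k)) ∧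
      ¬ ∃ C : Set (Fin N), HasLayers (fun i : Fin N => (i : ℕ)) (fun i => (π i : ℕ)) [s] C ∧
        ∀ k ∈ C, ∀ k' ∈ C, F k (π k')} := by
  classical
  have hex : ∀ k, ∃ y, N ≤ y ∨ F k (N - 1 - y) := fun k => ⟨N, Or.inl le_rfl⟩
  set b : ℕ → ℕ := fun k => Nat.find (hex k)
  have hbiff : ∀ k y, b k ≤ y ↔ N ≤ y ∨ F k (N - 1 - y) := by
    intro k y
    constructor
    · intro h
      rcases Nat.find_spec (hex k) with h1 | h1
      · exact Or.inl (h1.trans h)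
      · exact Or.inr (hF k k _ _ le_rfl (Nat.sub_le_sub_left h _) h1)
    · exact fun h => Nat.find_min' (hex k) h
  have hb : Antitone b := fun k k' hk => by
    rw [hbiff]
    rcases (hbiff k (b k)).1 le_rfl with h | h
    · exact Or.inl h
    · exact Or.inr (hF _ _ _ _ hk le_rfl h)
  have hbN : ∀ k, b k ≤ N := fun k => (hbiff k N).2 (Or.inl le_rfl)
  obtain ⟨u₀, hu₀⟩ := hWn
  let α : (Fin T → W) → ℕ → ℕ := fun A => colWord (T * c) N c w (extend fun i => (A i).1)
  let β : (Fin T → W) → ℕ → ℕ := fun B y => rowWord L c w (extend fun i => (B i).1) (N - 1 - y)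
  have hcnt : ∀ A : Fin T → W, ∀ i < T, ∀ t, cntBefore (extend (fun i => (A i).1) i) c t = κ t := by
    intro A i hi t
    rw [extend, dif_pos hi]
    exact hW _ (A ⟨i, hi⟩).2 t
  have hballot : ∀ A B, Ballot N b (α A) (β B) := by
    intro A B
    subst hN
    refine ballot_of_window (s := s) (κ := κ) (fun t => ?_) (hcnt A) (hcnt B) hw2 hw3
      (fun i _ => hw0 i) (fun t ht => ?_) (fun k y hy => ?_) (fun k y hy => ?_)
    · rw [← hW u₀ hu₀ t]
      have := cntBefore_add_le (letters u₀) 0 c t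
      simpa [cntBefore] using this
    · rw [← hW u₀ hu₀ t]
      exact cntBefore_eq_zero fun i _ => by have := letters_lt hs u₀ i; omega
    · rcases Nat.eq_zero_or_pos y with h | h
      · exact Or.inl h
      have h1 := hbN k
      have h2 : ¬ b k ≤ y - 1 := by omega
      rw [hbiff] at h2
      by_contra hcon
      exact h2 (Or.inr (hlow k (T * c + L - 1 - (y - 1)) (by omega) (by omega)))
    · rcases (hbiff k y).1 hy with h | h
      · omega
      · have := hup _ _ h
        omega
  have hα : ∀ A, ∀ k < N, 1 ≤ α A k := by
    intro A k hk
    simp only [α, colWord]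
    split_ifs
    · exact one_le_extend _ _ _
    · exact hw1 _ (by omega)
  have hβ : ∀ B y, β B y < s := by
    intro B y
    simp only [β, rowWord]
    split_ifs
    · exact hw0 _
    · exact extend_lt hs _ _ _
  have h0 : ∀ A B, ∀ k < N, colAt b (α A) (β B) k N = 0 := fun A B =>
    (invariant hb (hbN 0) (hα A) (hballot A B) N le_rfl).2.2
  choose π hπ using fun A B => exists_perm (h0 A B) (hα A)
  let Φ : (Fin T → W) × (Fin T → W) → {π : Equiv.Perm (Fin N) // (∀ k : Fin N, F k (π k)) ∧
      ¬ ∃ C : Set (Fin N), HasLayers (fun i : Fin N => (i : ℕ)) (fun i => (π i : ℕ)) [s] C ∧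
        ∀ k ∈ C, ∀ k' ∈ C, F k (π k')} := fun AB =>
    ⟨(π AB.1 AB.2).trans Fin.revPerm, fun k => by
      rcases (hbiff k _).1 (hπ AB.1 AB.2 k).1 with h | h
      · omega
      · simpa [Fin.val_rev, Nat.sub_sub, add_comm] using h, by
      rintro ⟨C, ⟨f, -, hfC, hf1, hf2, -⟩, hC⟩
      have hs0 : 0 < s := by omega
      let e : ℕ → Fin s := fun i => if h : i < s then ⟨i, h⟩ else ⟨0, hs0⟩
      have he : ∀ i, i < s - 1 → e i < e (i + 1) := fun i hi => by
        simp only [e]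
        rw [dif_pos (by omega), dif_pos (by omega)]
        exact Fin.lt_def.2 (Nat.lt_succ_self i)
      obtain ⟨k, y, hk⟩ := exists_hit_of_chain (b := b) (α := α AB.1) (β := β AB.2) hb (s - 1) 1
        le_rfl (fun i => f (e i)) (fun i => π AB.1 AB.2 (f (e i)))
        (fun i hi => hf1 (he i hi))
        (fun i hi => Fin.rev_lt_rev.1 (Fin.lt_def.2 (hf2 (he i hi))))
        (fun i _ => hπ AB.1 AB.2 _) (by
          rw [hbiff]
          have h1 := hC _ (hfC (e 0)) _ (hfC (e (s - 1)))
          refine Or.inr ?_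
          simpa [Fin.val_rev, Nat.sub_sub, add_comm] using h1)
      have h1 := rowLab_anti (b := b) (α := α AB.1) (β := β AB.2) y (Nat.zero_le k)
      have h2 := hk.2.1
      have h3 : rowLab b (α AB.1) (β AB.2) 0 y < s := hβ _ _
      simp only at h1
      omega⟩
  have hΦ : Function.Injective Φ := by
    rintro ⟨A, B⟩ ⟨A', B'⟩ h
    have h1 : π A B = π A' B' := by
      have h2 : (π A B).trans Fin.revPerm = (π A' B').trans Fin.revPerm := Subtype.ext_iff.1 h
      refine Equiv.ext fun i => ?_
      simpa using Equiv.congr_fun h2 i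
    obtain ⟨e1, e2⟩ := labels_eq (h0 A B) (h0 A' B') (hπ A B) (by rw [h1]; exact hπ A' B')
    refine Prod.ext ?_ ?_
    · have h2 : (fun i => (A i).1) = fun i => (A' i).1 := eq_of_concat_extend_eq fun m hm => by
        have := e1 m (by omega)
        simpa only [α, colWord, if_pos hm] using this
      exact funext fun i => Subtype.ext (congr_fun h2 i)
    · have h2 : (fun i => (B i).1) = fun i => (B' i).1 := eq_of_concat_extend_eq fun m hm => by
        have := e2 (N - 1 - (L + m)) (by omega)
        simp only [β, rowWord] at this
        rw [show N - 1 - (N - 1 - (L + m)) = L + m by omega, if_neg (by omega), if_neg (by omega),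
          Nat.add_sub_cancel_left] at this
        exact this
      exact funext fun i => Subtype.ext (congr_fun h2 i)
  have := Nat.card_le_card_of_injective Φ hΦ
  refine le_trans (le_of_eq ?_) this
  simp only [Nat.card_eq_fintype_card, Fintype.card_prod, Fintype.card_fun, Fintype.card_coe,
    Fintype.card_fin]
  rw [← pow_mul, ← pow_add]
  congr 1
  omega

end LabelGrowth

open LabelGrowth in
theorem exists_gadget_single {s c : ℕ} (hs : 2 ≤ s) {W : Finset (Fin c → Fin (s - 1))}
    (hWn : W.Nonempty) {κ : ℕ → ℕ} (hW : ∀ u ∈ W, ∀ t, cntBefore (letters u) c t = κ t) :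
    ∃ K, Gadget [s] c (W.card ^ 2) K := by
  obtain ⟨w, K, h0, h1, h2, h3⟩ := exists_buffer s (6 * c)
  refine ⟨K * 6, fun T F hF hlow hup => ?_⟩
  have e : K * 6 * c = K * (6 * c) := mul_assoc _ _ _
  refine le_trans ?_ (card_pow_le (T := T + 2) (L := K * 6 * c) hs (by ring) hWn hW
    (w := w) (fun i => by have := h0 i; omega) (by rwa [e]) (by rwa [e]) (by rwa [e]) hF hlow
    (fun k r h => ?_))
  · exact Nat.pow_le_pow_right (pow_pos (Finset.card_pos.2 hWn) 2) (by omega)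
  · have := hup k r h
    rw [add_mul] at this
    omega

theorem exists_mul_pow_le {x y : ℝ} (hy : 0 < y) (hyx : y < x) (d : ℕ) :
    ∃ δ : ℝ, 0 < δ ∧ ∀ c : ℕ, δ * ((c : ℝ) + 1) ^ d * y ^ c ≤ x ^ c := by
  have hx : 0 < x := hy.trans hyx
  have hr : 0 < y / x := div_pos hy hx
  have h := (tendsto_pow_const_mul_const_pow_of_abs_lt_one d
    (show |y / x| < 1 by rwa [abs_of_pos hr, div_lt_one hx])).bddAbove_range
  obtain ⟨B, hB⟩ := h
  have hB' : ∀ n : ℕ, (n : ℝ) ^ d * (y / x) ^ n ≤ B := fun n => hB ⟨n, rfl⟩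
  have hBpos : 0 < B := by
    refine lt_of_lt_of_le ?_ (hB' 1)
    simpa using hr
  refine ⟨y / x / B, div_pos hr hBpos, fun c => ?_⟩
  have h1 := hB' (c + 1)
  push_cast at h1
  rw [div_mul_eq_mul_div, div_mul_eq_mul_div, div_le_iff₀ hBpos]
  calc y / x * ((c : ℝ) + 1) ^ d * y ^ c = ((c : ℝ) + 1) ^ d * (y / x) ^ (c + 1) * x ^ c := by
        rw [pow_succ, div_pow]
        field_simp
    _ ≤ B * x ^ c := by gcongr
    _ = x ^ c * B := mul_comm _ _

open LabelGrowth in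
theorem gadgetGrows_single {s : ℕ} (hs : 2 ≤ s) : GadgetGrows [s] ((s : ℝ) - 1) := by
  classical
  intro y hy hyx
  have hx : (0 : ℝ) < (s : ℝ) - 1 := hy.trans hyx
  obtain ⟨δ, hδ, H⟩ := exists_mul_pow_le (pow_pos hy 2) (pow_lt_pow_left₀ hyx hy.le two_ne_zero)
    ((s - 1) * 2)
  refine ⟨δ, hδ, fun c => ?_⟩
  let content : (Fin c → Fin (s - 1)) → Fin (s - 1) → Fin (c + 1) := fun u t =>
    ⟨cntBefore (letters u) c (t + 1), by
      have := cntBefore_add_le (letters u) 0 c ((t : ℕ) + 1)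
      simp only [cntBefore, Finset.range_zero, Finset.filter_empty, Finset.card_empty, zero_add]
        at this ⊢
      omega⟩
  set β : ℝ := ((s : ℝ) - 1) ^ c / ((c : ℝ) + 1) ^ (s - 1) with hβ
  have hβpos : 0 < β := by positivity
  have hcast : ((s - 1 : ℕ) : ℝ) = (s : ℝ) - 1 := by rw [Nat.cast_sub (by omega)]; simp
  obtain ⟨κ, -, hκ⟩ := Finset.exists_le_card_fiber_of_nsmul_le_card_of_maps_to
    (s := (Finset.univ : Finset (Fin c → Fin (s - 1)))) (t := Finset.univ) (f := content) (b := β)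
    (fun _ _ => Finset.mem_univ _) ⟨fun _ => 0, Finset.mem_univ _⟩ (by
      simp only [Finset.card_univ, Fintype.card_fun, Fintype.card_fin, nsmul_eq_mul]
      push_cast
      rw [hβ, hcast, mul_div_cancel₀]
      positivity)
  set W := Finset.univ.filter fun u => content u = κ with hWdef
  have hWn : W.Nonempty := by
    rw [← Finset.card_pos]
    exact_mod_cast hβpos.trans_le hκ
  obtain ⟨u₀, hu₀⟩ := hWn
  obtain ⟨K, hK⟩ := exists_gadget_single hs ⟨u₀, hu₀⟩
    (κ := fun t => cntBefore (letters u₀) c t) fun u hu t => by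
      by_cases ht : 1 ≤ t ∧ t < s
      · have h1 : content u = content u₀ := by
          rw [(Finset.mem_filter.1 hu).2, (Finset.mem_filter.1 hu₀).2]
        have h2 := congr_arg Fin.val (congr_fun h1 ⟨t - 1, by omega⟩)
        simpa only [content, Nat.sub_add_cancel ht.1] using h2
      · rw [cntBefore_eq_zero, cntBefore_eq_zero]
        · intro i _
          have := letters_lt hs u₀ i
          have := one_le_letters u₀ i
          omega
        · intro i _
          have := letters_lt hs u i
          have := one_le_letters u i
          omega
  refine ⟨W.card ^ 2, K, ?_, hK⟩
  calc δ * y ^ (2 * c) ≤ β ^ 2 := by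
        rw [hβ, div_pow, le_div_iff₀ (by positivity), ← pow_mul, ← pow_mul, pow_mul,
          mul_comm c 2, pow_mul _ 2 c, mul_right_comm]
        exact H c
    _ ≤ ((W.card ^ 2 : ℕ) : ℝ) := by
        push_cast
        exact pow_le_pow_left₀ hβpos.le hκ 2

theorem exists_gadget_sum {a b : ℕ} {l : List ℕ} (ha : 0 < a) (hb : 0 < b) {c : ℕ}
    (hD : 0 < layAvoid c (a :: b :: l)) :
    Gadget (a :: b :: l) c (layAvoid c (a :: b :: l)) 1 := by
  classical
  intro T F hF hlow hup
  obtain ⟨σ₀, hσ₀⟩ : Nonempty {p : Equiv.Perm (Fin c) // ¬ HasLayers (fun i : Fin c => (i : ℕ))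
      (fun i => (p i : ℕ)) (a :: b :: l) Set.univ} := (Nat.card_pos_iff.1 hD).1
  let σ : (Fin T → {p : Equiv.Perm (Fin c) // ¬ HasLayers (fun i : Fin c => (i : ℕ))
      (fun i => (p i : ℕ)) (a :: b :: l) Set.univ}) → Fin (T + 1 + 2) → Equiv.Perm (Fin c) :=
    fun A t => if h : (t : ℕ) < T then (A ⟨t, h⟩).1 else σ₀
  have hσ : ∀ A t, ¬ HasLayers (fun i : Fin c => (i : ℕ)) (fun i => (σ A t i : ℕ))
      (a :: b :: l) Set.univ := by
    intro A t
    simp only [σ]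
    split_ifs with h
    · exact (A _).2
    · exact hσ₀
  let e : Fin ((T + 1 + 2) * c) ≃ Fin (T + 1 + 2) × Fin c := finProdFinEquiv.symm
  have he : ∀ i : Fin ((T + 1 + 2) * c), (i : ℕ) = (e i).2 + c * (e i).1 := fun i => by
    rw [← finProdFinEquiv_apply_val]
    simp only [e, Equiv.apply_symm_apply]
  let π : (Fin T → _) → Equiv.Perm (Fin ((T + 1 + 2) * c)) := fun A =>
    (e.trans (Equiv.prodShear (Equiv.refl _) (σ A))).trans e.symm
  have hπ1 : ∀ A i, (e (π A i)).1 = (e i).1 := fun A i => by simp [π]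
  have hπ2 : ∀ A i, (e (π A i)).2 = σ A (e i).1 (e i).2 := fun A i => by simp [π]
  have hblk : ∀ i j, i < j → (e i).1 ≤ (e j).1 := fun i j hij => by
    by_contra! h
    have h1 := he i
    have h2 := he j
    have h3 : c * ((e j).1 + 1) ≤ c * (e i).1 := Nat.mul_le_mul_left _ h
    have := (e j).2.2
    have : (i : ℕ) < j := hij
    rw [mul_add] at h3
    omega
  have hmod : ∀ i j, (e i).1 = (e j).1 → i < j → (e i).2 < (e j).2 := fun i j h hij => by
    have h1 := he i
    have h2 := he j
    rw [h] at h1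
    have : (i : ℕ) < j := hij
    rw [Fin.lt_def]
    omega
  refine le_trans (le_of_eq ?_) (Nat.card_le_card_of_injective
    (α := Fin T → {p : Equiv.Perm (Fin c) // ¬ HasLayers (fun i : Fin c => (i : ℕ))
      (fun i => (p i : ℕ)) (a :: b :: l) Set.univ}) (fun A => ⟨π A, fun k => hlow _ _ ?_ (π A k).2,
      ?_⟩) ?_)
  · rw [Nat.card_fun, Nat.card_eq_fintype_card (α := Fin T), Fintype.card_fin, layAvoid]
  · have h1 := he k
    have h2 := he (π A k)
    have := (e (π A k)).2.2
    rw [hπ1] at h2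
    omega
  · rintro ⟨C, hC, -⟩
    obtain ⟨t, ht⟩ := hC.exists_block (blk := fun i => ((e i).1 : ℕ)) ha hb
      (fun i _ j _ hij => hblk i j hij) (fun i _ j _ hij => by
        have := hblk _ _ (Fin.lt_def.2 hij)
        rwa [hπ1, hπ1] at this)
    obtain ⟨i₀, -, hi₀⟩ := ht.nonempty ha
    subst hi₀
    refine hσ A (e i₀).1 ((ht.image (x' := fun i : Fin c => (i : ℕ))
      (z' := fun i => (σ A (e i₀).1 i : ℕ)) (fun i => (e i).2) ?_ ?_).mono (Set.subset_univ _))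
    · rintro i ⟨-, hi⟩ j ⟨-, hj⟩ hij
      exact hmod i j (Fin.ext (hi.trans hj.symm)) hij
    · rintro i ⟨-, hi⟩ j ⟨-, hj⟩ hij
      have := hmod _ _ (by rw [hπ1, hπ1]; exact Fin.ext (hi.trans hj.symm)) (Fin.lt_def.2 hij)
      rw [hπ2, hπ2] at this
      rwa [Fin.ext hi, Fin.ext hj] at this
  · intro A A' h
    have h1 : π A = π A' := Subtype.ext_iff.1 h
    funext t
    refine Subtype.ext (Equiv.ext fun j => ?_)
    let t' : Fin (T + 1 + 2) := ⟨t, by omega⟩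
    have h2 := hπ2 A (e.symm (t', j))
    rw [h1, hπ2] at h2
    simpa [σ, t'] using h2.symm

theorem Grows.gadgetGrows {a b : ℕ} {l : List ℕ} {x : ℝ} (ha : 0 < a) (hb : 0 < b)
    (h : Grows (a :: b :: l) x) : GadgetGrows (a :: b :: l) x := fun y hy hyx => by
  obtain ⟨δ, hδ, H⟩ := h y hy hyx
  refine ⟨δ, hδ, fun c => ⟨_, 1, H c, exists_gadget_sum ha hb ?_⟩⟩
  exact_mod_cast (by positivity : 0 < δ * y ^ (2 * c)).trans_le (H c)

namespace Coloring

variable {R : Type*} {N n : ℕ}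

/-- The permutation whose red points have positions `E₁ ∘ Sum.inl` and values `E₂ ∘ Sum.inl`, and
whose blue points form a copy of `π` on the remaining positions and values. -/
def glue (E₁ E₂ : R ⊕ Fin N ≃ Fin n) (π : Equiv.Perm (Fin N)) : Equiv.Perm (Fin n) :=
  E₁.symm.trans (((Equiv.refl R).sumCongr π).trans E₂)

/-- The cell in blue column `k` and blue row `r` lies to the right of and below an increasing chain
of `a` red points. -/
def Covers (E₁ E₂ : R ⊕ Fin N ≃ Fin n) (a : ℕ) (k r : Fin N) : Prop :=
  ∃ f : Fin a → R, StrictMono (fun j => E₁ (Sum.inl (f j))) ∧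
    StrictMono (fun j => E₂ (Sum.inl (f j))) ∧
    ∀ j, E₁ (Sum.inl (f j)) < E₁ (Sum.inr k) ∧ E₂ (Sum.inr r) < E₂ (Sum.inl (f j))

/-- The red points avoid `[a, 1]`, and all blue points are covered by red chains. -/
structure IsColoring (E₁ E₂ : R ⊕ Fin N ≃ Fin n) (π : Equiv.Perm (Fin N)) (a : ℕ) : Prop where
  mono_col : StrictMono fun k => E₁ (Sum.inr k)
  mono_row : StrictMono fun k => E₂ (Sum.inr k)
  red : ¬ HasLayers (fun i => (E₁ (Sum.inl i) : ℕ)) (fun i => (E₂ (Sum.inl i) : ℕ)) [a, 1] Set.univ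
  blue : ∀ k, Covers E₁ E₂ a k (π k)

/-- The point at position `i` of `p` lies to the right of and below an increasing chain of length
`a`. -/
def Seen (p : Equiv.Perm (Fin n)) (a : ℕ) (i : Fin n) : Prop :=
  ∃ f : Fin a → Fin n, StrictMono f ∧ StrictMono (p ∘ f) ∧ ∀ j, f j < i ∧ p i < p (f j)

variable {E₁ E₂ : R ⊕ Fin N ≃ Fin n} {π : Equiv.Perm (Fin N)} {a : ℕ}

theorem glue_inl (i : R) : glue E₁ E₂ π (E₁ (Sum.inl i)) = E₂ (Sum.inl i) := by simp [glue]

theorem glue_inr (k : Fin N) : glue E₁ E₂ π (E₁ (Sum.inr k)) = E₂ (Sum.inr (π k)) := by simp [glue]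

theorem IsColoring.exists_red (h : IsColoring E₁ E₂ π a) {f : Fin a → Fin n} (hf : StrictMono f)
    (hf' : StrictMono (glue E₁ E₂ π ∘ f)) : ∃ g : Fin a → R,
      StrictMono (fun j => E₁ (Sum.inl (g j))) ∧ StrictMono (fun j => E₂ (Sum.inl (g j))) ∧
      ∀ i j : Fin n, (∀ t, f t < i ∧ j < glue E₁ E₂ π (f t)) →
        ∀ t, E₁ (Sum.inl (g t)) < i ∧ j < E₂ (Sum.inl (g t)) := by
  by_cases hr : ∀ t, ∃ r, f t = E₁ (Sum.inl r)
  · choose g hg using hr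
    obtain rfl : f = fun t => E₁ (Sum.inl (g t)) := funext hg
    simp only [Function.comp_def, glue_inl] at hf' ⊢
    exact ⟨g, hf, hf', fun i j h => h⟩
  · push Not at hr
    obtain ⟨t, ht⟩ := hr
    obtain ⟨k, hk⟩ : ∃ k, f t = E₁ (Sum.inr k) := by
      obtain ⟨y, hy⟩ := E₁.surjective (f t)
      rcases y with r | k
      · exact absurd hy.symm (ht r)
      · exact ⟨k, hy.symm⟩
    obtain ⟨g, h1, h2, h3⟩ := h.blue k
    refine ⟨g, h1, h2, fun i j hij s => ?_⟩
    have h4 := hij t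
    rw [hk, glue_inr] at h4
    exact ⟨(h3 s).1.trans h4.1, h4.2.trans (h3 s).2⟩

theorem IsColoring.not_seen (h : IsColoring E₁ E₂ π a) (r : R) :
    ¬ Seen (glue E₁ E₂ π) a (E₁ (Sum.inl r)) := by
  rintro ⟨f, h1, h2, h3⟩
  obtain ⟨g, h4, h5, h6⟩ := h.exists_red h1 h2
  have h7 := h6 _ _ h3
  rw [glue_inl] at h7
  refine h.red ⟨g, {r}, fun _ => Set.mem_univ _, h4, h5, Set.subset_univ _,
    ⟨fun _ => r, ∅, fun _ => rfl, Subsingleton.strictMono _, Subsingleton.strictMono _,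
      Set.empty_subset _, trivial, fun _ _ h => h.elim⟩, ?_⟩
  rintro j _ rfl
  exact h7 j

theorem IsColoring.seen (h : IsColoring E₁ E₂ π a) (k : Fin N) :
    Seen (glue E₁ E₂ π) a (E₁ (Sum.inr k)) := by
  obtain ⟨g, h1, h2, h3⟩ := h.blue k
  refine ⟨fun j => E₁ (Sum.inl (g j)), h1, ?_, fun j => ?_⟩
  · simpa only [Function.comp_def, glue_inl] using h2
  · rw [glue_inl, glue_inr]
    exact h3 j

theorem IsColoring.range_inr (h : IsColoring E₁ E₂ π a) :
    Set.range (fun k => E₁ (Sum.inr k)) = {i | Seen (glue E₁ E₂ π) a i} := by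
  ext i
  obtain ⟨y, rfl⟩ := E₁.surjective i
  rcases y with r | k
  · simpa using h.not_seen r
  · simpa using h.seen k

theorem IsColoring.range_inl (h : IsColoring E₁ E₂ π a) :
    Set.range (fun r => E₁ (Sum.inl r)) = {i | ¬ Seen (glue E₁ E₂ π) a i} := by
  ext i
  obtain ⟨y, rfl⟩ := E₁.surjective i
  rcases y with r | k
  · simpa using h.not_seen r
  · simpa using h.seen k

theorem IsColoring.avoids (h : IsColoring E₁ E₂ π a) {v : List ℕ}
    (hv : ¬ ∃ C : Set (Fin N), HasLayers (fun i : Fin N => (i : ℕ)) (fun i => (π i : ℕ)) v C ∧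
      ∀ k ∈ C, ∀ k' ∈ C, Covers E₁ E₂ a k (π k')) :
    ¬ HasLayers (fun i : Fin n => (i : ℕ)) (fun i => (glue E₁ E₂ π i : ℕ)) (a :: v) Set.univ := by
  rintro ⟨f, C, -, h1, h2, -, h3, h4⟩
  obtain ⟨g, h5, h6, h7⟩ := h.exists_red h1 h2
  have hC : C ⊆ Set.range fun k => E₁ (Sum.inr k) := fun i hi => by
    rw [h.range_inr]
    exact ⟨f, h1, h2, fun j => h4 j i hi⟩
  refine hv ⟨_, (((h3.preimage (fun k => E₁ (Sum.inr k)) hC).image (x' := fun i : Fin N => (i : ℕ))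
    (z' := fun i => (π i : ℕ)) id (fun i _ j _ hij => h.mono_col.lt_iff_lt.1 hij)
      fun i _ j _ hij => ?_)), ?_⟩
  · simp only [glue_inr] at hij
    exact h.mono_row.lt_iff_lt.1 hij
  · rintro _ ⟨k, hk, rfl⟩ _ ⟨k', hk', rfl⟩
    refine ⟨g, h5, h6, h7 _ _ fun t => ⟨(h4 t _ hk).1, ?_⟩⟩
    have := (h4 t _ hk').2
    simp only [glue_inr] at this
    exact this

theorem IsColoring.eq_of_glue_eq [LinearOrder R] [WellFoundedLT R] {E₁' E₂' : R ⊕ Fin N ≃ Fin n}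
    {π' : Equiv.Perm (Fin N)} (h : IsColoring E₁ E₂ π a) (h' : IsColoring E₁' E₂' π' a)
    (hR : StrictMono fun r => E₁ (Sum.inl r)) (hR' : StrictMono fun r => E₁' (Sum.inl r))
    (he : glue E₁ E₂ π = glue E₁' E₂' π') : E₁ = E₁' ∧ E₂ = E₂' ∧ π = π' := by
  have hl := (hR.range_inj hR').1 (by rw [h.range_inl, h'.range_inl, he])
  have hr := (h.mono_col.range_inj h'.mono_col).1 (by rw [h.range_inr, h'.range_inr, he])
  obtain rfl : E₁ = E₁' := Equiv.ext fun y => by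
    rcases y with r | k
    exacts [congr_fun hl r, congr_fun hr k]
  have hl2 : ∀ r, E₂ (Sum.inl r) = E₂' (Sum.inl r) := fun r => by
    have := Equiv.congr_fun he (E₁ (Sum.inl r))
    rwa [glue_inl, glue_inl] at this
  have hr2 : ∀ k, E₂ (Sum.inr (π k)) = E₂' (Sum.inr (π' k)) := fun k => by
    have := Equiv.congr_fun he (E₁ (Sum.inr k))
    rwa [glue_inr, glue_inr] at this
  have hr3 := (h.mono_row.range_inj h'.mono_row).1 (by
    ext i
    constructor
    · rintro ⟨k, rfl⟩
      exact ⟨π' (π.symm k), by simp [← hr2]⟩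
    · rintro ⟨k, rfl⟩
      exact ⟨π (π'.symm k), by simp [hr2]⟩)
  obtain rfl : E₂ = E₂' := Equiv.ext fun y => by
    rcases y with r | k
    exacts [hl2 r, congr_fun hr3 k]
  exact ⟨rfl, rfl, Equiv.ext fun k => Sum.inr_injective (E₂.injective (hr2 k))⟩

end Coloring

theorem exists_rank {I : Type*} [Fintype I] {n : ℕ} (hn : Fintype.card I = n) {x : I → ℕ}
    (hx : Function.Injective x) : ∃ E : I ≃ Fin n, ∀ i j, E i < E j ↔ x i < x j := by
  let inst : LinearOrder I := LinearOrder.lift' x hx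
  exact ⟨(Fintype.orderIsoFinOfCardEq I hn).symm.toEquiv,
    fun i j => (Fintype.orderIsoFinOfCardEq I hn).symm.lt_iff_lt⟩

theorem equiv_eq_of_lt_iff {I : Type*} {n : ℕ} {e e' : I ≃ Fin n}
    (h : ∀ i j, e i < e j ↔ e' i < e' j) : e = e' := by
  have h1 : StrictMono fun i => e (e'.symm i) := fun i j hij => by
    rw [h]
    simpa using hij
  have h2 := (h1.range_inj (g := id) strictMono_id).1 (by
    rw [Set.range_id]
    exact (e'.symm.trans e).surjective.range_eq)
  exact Equiv.ext fun i => by simpa using congr_fun h2 (e' i)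

theorem mul_add_lt_iff {w u u' e e' : ℕ} (he : e < w) (he' : e' < w) :
    w * u + e < w * u' + e' ↔ u < u' ∨ u = u' ∧ e < e' := by
  constructor
  · intro h
    rcases lt_trichotomy u u' with h1 | rfl | h1
    · exact Or.inl h1
    · exact Or.inr ⟨rfl, by omega⟩
    · have : w * (u' + 1) ≤ w * u := Nat.mul_le_mul_left _ h1
      rw [mul_add] at this
      omega
  · rintro (h | ⟨rfl, h⟩)
    · have : w * (u + 1) ≤ w * u' := Nat.mul_le_mul_left _ h
      rw [mul_add] at this
      omega
    · omega

/-- The ways to interleave `m` red lines and `c` blue lines. -/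
abbrev Shuffle (m c : ℕ) : Type :=
  {e : Fin m ⊕ Fin c ≃ Fin (m + c) //
    (StrictMono fun i => e (Sum.inl i)) ∧ StrictMono fun i => e (Sum.inr i)}

theorem choose_le_card_shuffle (m c : ℕ) : (m + c).choose m ≤ Nat.card (Shuffle m c) := by
  have h1 : ∀ S : {S : Finset (Fin (m + c)) // S.card = m}, S.1ᶜ.card = c := fun S => by
    rw [Finset.card_compl, S.2, Fintype.card_fin, Nat.add_sub_cancel_left]
  have h2 := Nat.card_le_card_of_injective
    (fun S : {S : Finset (Fin (m + c)) // S.card = m} =>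
      (⟨finSumEquivOfFinset S.2 (h1 S), fun i j hij => by simpa using hij,
        fun i j hij => by simpa using hij⟩ : Shuffle m c)) fun S S' h => by
      have h3 := Subtype.ext_iff.1 h
      have h4 : ∀ S : {S : Finset (Fin (m + c)) // S.card = m}, (S.1 : Set (Fin (m + c))) =
          Set.range fun i => finSumEquivOfFinset S.2 (h1 S) (Sum.inl i) := fun S => by simp
      refine Subtype.ext (Finset.coe_injective ?_)
      rw [h4 S, h4 S']
      simp only at h3
      rw [h3]
  refine le_trans (le_of_eq ?_) h2
  rw [Nat.card_eq_fintype_card, Fintype.card_finset_len, Fintype.card_fin]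

namespace Coloring

/-- Permutations of length `m` that avoid `[a, 1]` but contain an increasing chain of length `a`. -/
abbrev RedPerm (m a : ℕ) : Type :=
  {ρ : Equiv.Perm (Fin m) //
    ¬ HasLayers (fun i : Fin m => (i : ℕ)) (fun i => (ρ i : ℕ)) [a, 1] Set.univ ∧
    ∃ f : Fin a → Fin m, StrictMono f ∧ StrictMono (ρ ∘ f)}

variable {T K m c a : ℕ}

/-- Columns: the red columns are split into `T + 2` strips, and the `t`-th group of `c` blue columns
is shuffled into strip `t + 1`. -/
def colKey (P : ℕ → Shuffle m c) : (Fin (T + 2) ×ₗ Fin m) ⊕ Fin ((T + K + 2) * c) → ℕ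
  | Sum.inl r => (m + c) * (ofLex r).1 + (P (ofLex r).1).1 (Sum.inl (ofLex r).2)
  | Sum.inr k => (m + c) * (k.divNat + 1) + (P (k.divNat + 1)).1 (Sum.inr k.modNat)

/-- Rows: like columns, but with the blue rows moved down by `K + 2` strips. -/
def rowKey (Q : ℕ → Shuffle m c) (ρ : ℕ → RedPerm m a) :
    (Fin (T + 2) ×ₗ Fin m) ⊕ Fin ((T + K + 2) * c) → ℕ
  | Sum.inl r => (m + c) * ((ofLex r).1 + (K + 2)) +
      (Q (ofLex r).1).1 (Sum.inl ((ρ (ofLex r).1).1 (ofLex r).2))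
  | Sum.inr k => (m + c) * (k.divNat + 1) + (Q (k.divNat + 1 - (K + 2))).1 (Sum.inr k.modNat)

theorem divNat_modNat_lt {M c : ℕ} {k k' : Fin (M * c)} (h : k < k') :
    (k.divNat : ℕ) < k'.divNat ∨ (k.divNat : ℕ) = k'.divNat ∧ k.modNat < k'.modNat := by
  have h1 := Nat.div_le_div_right (c := c) (Fin.lt_def.1 h).le
  simp only [Fin.coe_divNat, Fin.lt_def, Fin.coe_modNat]
  rcases h1.lt_or_eq with h2 | h2
  · exact Or.inl h2
  · refine Or.inr ⟨h2, ?_⟩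
    have h3 := Nat.div_add_mod (k : ℕ) c
    have h4 := Nat.div_add_mod (k' : ℕ) c
    rw [← h2] at h4
    have : (k : ℕ) < k' := h
    omega

theorem colKey_inr_strictMono (P : ℕ → Shuffle m c) :
    StrictMono fun k => colKey (T := T) (K := K) P (Sum.inr k) := fun k k' h => by
  simp only [colKey]
  rw [mul_add_lt_iff (Fin.is_lt _) (Fin.is_lt _)]
  rcases divNat_modNat_lt h with h1 | ⟨h1, h2⟩
  · exact Or.inl (by omega)
  · rw [h1]
    exact Or.inr ⟨rfl, (P _).2.2 h2⟩

theorem rowKey_inr_strictMono (Q : ℕ → Shuffle m c) (ρ : ℕ → RedPerm m a) :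
    StrictMono fun k => rowKey (T := T) (K := K) Q ρ (Sum.inr k) := fun k k' h => by
  simp only [rowKey]
  rw [mul_add_lt_iff (Fin.is_lt _) (Fin.is_lt _)]
  rcases divNat_modNat_lt h with h1 | ⟨h1, h2⟩
  · exact Or.inl (by omega)
  · rw [h1]
    exact Or.inr ⟨rfl, (Q _).2.2 h2⟩

theorem colKey_inl_lt_iff (P : ℕ → Shuffle m c) (r r' : Fin (T + 2) ×ₗ Fin m) :
    colKey (K := K) P (Sum.inl r) < colKey (K := K) P (Sum.inl r') ↔
      (ofLex r).1 < (ofLex r').1 ∨ (ofLex r).1 = (ofLex r').1 ∧ (ofLex r).2 < (ofLex r').2 := by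
  simp only [colKey]
  rw [mul_add_lt_iff (Fin.is_lt _) (Fin.is_lt _), Fin.lt_def, ← Fin.ext_iff]
  refine or_congr Iff.rfl (and_congr_right fun h => ?_)
  rw [h, ← Fin.lt_def, (P _).2.1.lt_iff_lt]

theorem rowKey_inl_lt_iff (Q : ℕ → Shuffle m c) (ρ : ℕ → RedPerm m a)
    (r r' : Fin (T + 2) ×ₗ Fin m) :
    rowKey (K := K) Q ρ (Sum.inl r) < rowKey (K := K) Q ρ (Sum.inl r') ↔
      (ofLex r).1 < (ofLex r').1 ∨ (ofLex r).1 = (ofLex r').1 ∧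
        (ρ (ofLex r).1).1 (ofLex r).2 < (ρ (ofLex r).1).1 (ofLex r').2 := by
  simp only [rowKey]
  rw [mul_add_lt_iff (Fin.is_lt _) (Fin.is_lt _), Fin.lt_def, add_left_inj, ← Fin.ext_iff,
    Nat.add_lt_add_iff_right]
  refine or_congr Iff.rfl (and_congr_right fun h => ?_)
  rw [h, ← Fin.lt_def, (Q _).2.1.lt_iff_lt]

theorem mul_add_inj {w u u' e e' : ℕ} (he : e < w) (he' : e' < w)
    (h : w * u + e = w * u' + e') : u = u' ∧ e = e' := by
  have h1 := (mul_add_lt_iff (u := u) (u' := u') he he').not.1 h.not_lt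
  have h2 := (mul_add_lt_iff (u := u') (u' := u) he' he).not.1 h.not_gt
  omega

theorem colKey_injective (P : ℕ → Shuffle m c) :
    Function.Injective (colKey (T := T) (K := K) P) := by
  have key : ∀ r k, colKey (T := T) (K := K) P (Sum.inl r) ≠
      colKey (T := T) (K := K) P (Sum.inr k) := fun r k h => by
    obtain ⟨h1, h2⟩ := mul_add_inj (Fin.is_lt _) (Fin.is_lt _) h
    rw [h1] at h2
    exact Sum.inl_ne_inr ((P _).1.injective (Fin.ext h2))
  rintro (r | k) (r' | k') h
  · have h1 := (colKey_inl_lt_iff P r r').not.1 h.not_lt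
    have h2 := (colKey_inl_lt_iff P r' r).not.1 h.not_gt
    refine congr_arg Sum.inl (ofLex.injective (Prod.ext ?_ ?_)) <;> grind
  · exact absurd h (key _ _)
  · exact absurd h.symm (key _ _)
  · exact congr_arg Sum.inr ((colKey_inr_strictMono P).injective h)

theorem rowKey_injective (Q : ℕ → Shuffle m c) (ρ : ℕ → RedPerm m a) :
    Function.Injective (rowKey (T := T) (K := K) Q ρ) := by
  have key : ∀ r k, rowKey (T := T) (K := K) Q ρ (Sum.inl r) ≠
      rowKey (T := T) (K := K) Q ρ (Sum.inr k) := fun r k h => by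
      obtain ⟨h1, h2⟩ := mul_add_inj (Fin.is_lt _) (Fin.is_lt _) h
      rw [← h1, Nat.add_sub_cancel] at h2
      exact Sum.inl_ne_inr ((Q _).1.injective (Fin.ext h2))
  rintro (r | k) (r' | k') h
  · have h1 := (rowKey_inl_lt_iff Q ρ r r').not.1 h.not_lt
    have h2 := (rowKey_inl_lt_iff Q ρ r' r).not.1 h.not_gt
    have h3 : (ofLex r).1 = (ofLex r').1 := by grind
    refine congr_arg Sum.inl (ofLex.injective (Prod.ext h3 ?_))
    rw [h3] at h1 h2
    apply (ρ (ofLex r').1).1.injective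
    grind
  · exact absurd h (key _ _)
  · exact absurd h.symm (key _ _)
  · exact congr_arg Sum.inr ((rowKey_inr_strictMono Q ρ).injective h)

end Coloring

namespace Coloring

variable {T K m c a : ℕ}

theorem card_index (T K m c : ℕ) :
    Fintype.card ((Fin (T + 2) ×ₗ Fin m) ⊕ Fin ((T + K + 2) * c)) =
      (T + 2) * m + (T + K + 2) * c := by
  simp [Fintype.card_lex]

theorem exists_colRank (P : ℕ → Shuffle m c) :
    ∃ E : (Fin (T + 2) ×ₗ Fin m) ⊕ Fin ((T + K + 2) * c) ≃ Fin ((T + 2) * m + (T + K + 2) * c),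
      ∀ i j, E i < E j ↔ colKey P i < colKey P j :=
  exists_rank (card_index T K m c) (colKey_injective P)

theorem exists_rowRank (Q : ℕ → Shuffle m c) (ρ : ℕ → RedPerm m a) :
    ∃ E : (Fin (T + 2) ×ₗ Fin m) ⊕ Fin ((T + K + 2) * c) ≃ Fin ((T + 2) * m + (T + K + 2) * c),
      ∀ i j, E i < E j ↔ rowKey Q ρ i < rowKey Q ρ j :=
  exists_rank (card_index T K m c) (rowKey_injective Q ρ)

/-- The blue cells covered by red chains, as a relation on natural numbers. -/
def CoversNat {R : Type*} {N n : ℕ} (E₁ E₂ : R ⊕ Fin N ≃ Fin n) (a k r : ℕ) : Prop :=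
  ∃ hr : r < N, ∀ hk : k < N, Covers E₁ E₂ a ⟨k, hk⟩ ⟨r, hr⟩

theorem coversNat_iff {R : Type*} {N n : ℕ} {E₁ E₂ : R ⊕ Fin N ≃ Fin n} {a : ℕ} {k r : Fin N} :
    CoversNat E₁ E₂ a k r ↔ Covers E₁ E₂ a k r :=
  ⟨fun ⟨_, h⟩ => h k.2, fun h => ⟨r.2, fun _ => h⟩⟩

theorem CoversNat.mono {R : Type*} {N n : ℕ} {E₁ E₂ : R ⊕ Fin N ≃ Fin n} {a : ℕ}
    (h1 : StrictMono fun k => E₁ (Sum.inr k)) (h2 : StrictMono fun k => E₂ (Sum.inr k))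
    {k k' r r' : ℕ} (hk : k ≤ k') (hr : r' ≤ r) (h : CoversNat E₁ E₂ a k r) :
    CoversNat E₁ E₂ a k' r' := by
  obtain ⟨h3, h4⟩ := h
  refine ⟨hr.trans_lt h3, fun h5 => ?_⟩
  obtain ⟨f, h6, h7, h8⟩ := h4 (hk.trans_lt h5)
  exact ⟨f, h6, h7, fun j => ⟨(h8 j).1.trans_le (h1.monotone hk), (h2.monotone hr).trans_lt (h8 j).2⟩⟩

section

variable {E₁ E₂ : (Fin (T + 2) ×ₗ Fin m) ⊕ Fin ((T + K + 2) * c) ≃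
    Fin ((T + 2) * m + (T + K + 2) * c)}
  {P Q : ℕ → Shuffle m c} {ρ : ℕ → RedPerm m a}

theorem not_hasLayers_red (h1 : ∀ i j, E₁ i < E₁ j ↔ colKey P i < colKey P j)
    (h2 : ∀ i j, E₂ i < E₂ j ↔ rowKey Q ρ i < rowKey Q ρ j) (ha : 0 < a) :
    ¬ HasLayers (fun i => (E₁ (Sum.inl i) : ℕ)) (fun i => (E₂ (Sum.inl i) : ℕ)) [a, 1]
      Set.univ := by
  intro h
  obtain ⟨t, ht⟩ := h.exists_block (blk := fun r => ((ofLex r).1 : ℕ)) ha one_pos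
    (fun i _ j _ hij => by
      have := (colKey_inl_lt_iff P i j).1 ((h1 _ _).1 hij)
      rcases this with h | h
      exacts [h.le, (congr_arg Fin.val h.1).le])
    (fun i _ j _ hij => by
      have := (rowKey_inl_lt_iff Q ρ i j).1 ((h2 _ _).1 hij)
      rcases this with h | h
      exacts [h.le, (congr_arg Fin.val h.1).le])
  refine (ρ t).2.1 ((ht.image (fun r => (ofLex r).2) ?_ ?_).mono (Set.subset_univ _))
  · rintro i ⟨-, rfl⟩ j ⟨-, hj⟩ hij
    rcases (colKey_inl_lt_iff P i j).1 ((h1 _ _).1 hij) with h | h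
    · exact absurd (Fin.ext hj) h.ne'
    · exact h.2
  · rintro i ⟨-, rfl⟩ j ⟨-, hj⟩ hij
    rcases (rowKey_inl_lt_iff Q ρ i j).1 ((h2 _ _).1 hij) with h | h
    · exact absurd (Fin.ext hj) h.ne'
    · exact h.2

theorem coversNat_of_lt (h1 : ∀ i j, E₁ i < E₁ j ↔ colKey P i < colKey P j)
    (h2 : ∀ i j, E₂ i < E₂ j ↔ rowKey Q ρ i < rowKey Q ρ j) {k r : ℕ} (hkr : r < k + K * c)
    (hr : r < (T + K + 2) * c) : CoversNat E₁ E₂ a k r := by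
  refine ⟨hr, fun hk => ?_⟩
  have hc : 0 < c := Nat.pos_of_ne_zero fun h => by simp [h] at hr
  obtain ⟨s, hs, hsk, hsr⟩ : ∃ s, s < T + 2 ∧ s ≤ k / c ∧ r / c < s + K + 1 := by
    have h3 : r / c < k / c + K + 1 := by
      rw [Nat.div_lt_iff_lt_mul hc, add_mul, add_mul]
      have := Nat.div_add_mod k c
      have := Nat.mod_lt k hc
      rw [mul_comm c] at *
      omega
    have h4 : r / c < T + K + 2 := by rwa [Nat.div_lt_iff_lt_mul hc]
    exact ⟨min (k / c) (T + 1), by omega, min_le_left _ _, by omega⟩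
  obtain ⟨f, hf, hf'⟩ := (ρ s).2.2
  refine ⟨fun j => toLex (⟨s, hs⟩, f j), fun i j hij => ?_, fun i j hij => ?_, fun j => ⟨?_, ?_⟩⟩
  · exact (h1 _ _).2 ((colKey_inl_lt_iff _ _ _).2 (Or.inr ⟨rfl, hf hij⟩))
  · exact (h2 _ _).2 ((rowKey_inl_lt_iff _ _ _ _).2 (Or.inr ⟨rfl, hf' hij⟩))
  · rw [h1]
    exact (mul_add_lt_iff (Fin.is_lt _) (Fin.is_lt _)).2 (Or.inl (Nat.lt_succ_of_le hsk))
  · rw [h2]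
    exact (mul_add_lt_iff (Fin.is_lt _) (Fin.is_lt _)).2 (Or.inl (by
      change r / c + 1 < s + (K + 2)
      omega))

theorem CoversNat.lt (h1 : ∀ i j, E₁ i < E₁ j ↔ colKey P i < colKey P j)
    (h2 : ∀ i j, E₂ i < E₂ j ↔ rowKey Q ρ i < rowKey Q ρ j) (ha : 0 < a) {k r : ℕ}
    (h : CoversNat E₁ E₂ a k r) : r < k + (K + 3) * c := by
  obtain ⟨hr, h⟩ := h
  by_cases hk : k < (T + K + 2) * c
  · have hc : 0 < c := Nat.pos_of_ne_zero fun h => by simp [h] at hr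
    obtain ⟨f, -, -, h3⟩ := h hk
    obtain ⟨h4, h5⟩ := h3 ⟨0, ha⟩
    rw [h1] at h4
    rw [h2] at h5
    replace h4 := (mul_add_lt_iff (Fin.is_lt _) (Fin.is_lt _)).1 h4
    replace h5 := (mul_add_lt_iff (Fin.is_lt _) (Fin.is_lt _)).1 h5
    simp only [Fin.coe_divNat] at h4 h5
    have h6 : r / c < k / c + (K + 3) := by omega
    rw [Nat.div_lt_iff_lt_mul hc, add_mul] at h6
    have := Nat.div_mul_le_self k c
    omega
  · have : (T + K + 2) * c + (K + 3) * c ≥ (T + K + 2) * c := Nat.le_add_right _ _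
    omega

theorem strictMono_col_inl (h1 : ∀ i j, E₁ i < E₁ j ↔ colKey P i < colKey P j) :
    StrictMono fun r => E₁ (Sum.inl r) := fun i j hij => by
  rw [h1, colKey_inl_lt_iff]
  rcases Prod.Lex.lt_iff.1 hij with h | h
  · exact Or.inl h
  · exact Or.inr h

theorem strictMono_col_inr (h1 : ∀ i j, E₁ i < E₁ j ↔ colKey P i < colKey P j) :
    StrictMono fun k => E₁ (Sum.inr k) := fun _ _ hij => (h1 _ _).2 (colKey_inr_strictMono P hij)

theorem strictMono_row_inr (h2 : ∀ i j, E₂ i < E₂ j ↔ rowKey Q ρ i < rowKey Q ρ j) :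
    StrictMono fun k => E₂ (Sum.inr k) := fun _ _ hij => (h2 _ _).2 (rowKey_inr_strictMono Q ρ hij)

theorem shuffle_eq_of_colRank {P' : ℕ → Shuffle m c}
    (h1 : ∀ i j, E₁ i < E₁ j ↔ colKey P i < colKey P j)
    (h1' : ∀ i j, E₁ i < E₁ j ↔ colKey P' i < colKey P' j) {t : ℕ} (ht : t < T) :
    P (t + 1) = P' (t + 1) := by
  let y : Fin m ⊕ Fin c → (Fin (T + 2) ×ₗ Fin m) ⊕ Fin ((T + K + 2) * c) :=
    Sum.map (fun i => toLex (⟨t + 1, by omega⟩, i))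
      fun j => finProdFinEquiv (⟨t, by omega⟩, j)
  have hy : ∀ (P : ℕ → Shuffle m c) i, colKey P (y i) = (m + c) * (t + 1) + (P (t + 1)).1 i := by
    rintro P (i | j)
    · rfl
    · have h : finProdFinEquiv.symm (finProdFinEquiv ((⟨t, by omega⟩ : Fin (T + K + 2)), j)) =
          (⟨t, by omega⟩, j) := Equiv.symm_apply_apply _ _
      rw [finProdFinEquiv_symm_apply, Prod.mk.injEq] at h
      simp only [y, Sum.map_inr, colKey, h.1, h.2]
  refine Subtype.ext (equiv_eq_of_lt_iff fun i j => ?_)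
  have h3 := (h1 (y i) (y j)).symm.trans (h1' (y i) (y j))
  rwa [hy, hy, hy, hy, Nat.add_lt_add_iff_left, Nat.add_lt_add_iff_left, ← Fin.lt_def,
    ← Fin.lt_def] at h3

theorem redPerm_eq_of_rowRank {Q' : ℕ → Shuffle m c} {ρ' : ℕ → RedPerm m a}
    (h2 : ∀ i j, E₂ i < E₂ j ↔ rowKey Q ρ i < rowKey Q ρ j)
    (h2' : ∀ i j, E₂ i < E₂ j ↔ rowKey Q' ρ' i < rowKey Q' ρ' j) {t : ℕ} (ht : t < T) :
    ρ (t + 1) = ρ' (t + 1) := by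
  refine Subtype.ext (equiv_eq_of_lt_iff fun i j => ?_)
  have h3 := (h2 (Sum.inl (toLex (⟨t + 1, by omega⟩, i))) (Sum.inl (toLex (⟨t + 1, by omega⟩, j)))).symm.trans
    (h2' _ _)
  rw [rowKey_inl_lt_iff, rowKey_inl_lt_iff] at h3
  simpa using h3

theorem shuffle_eq_of_rowRank {Q' : ℕ → Shuffle m c} {ρ' : ℕ → RedPerm m a}
    (h2 : ∀ i j, E₂ i < E₂ j ↔ rowKey Q ρ i < rowKey Q ρ j)
    (h2' : ∀ i j, E₂ i < E₂ j ↔ rowKey Q' ρ' i < rowKey Q' ρ' j) {t : ℕ} (ht : t < T) :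
    Q (t + 1) = Q' (t + 1) := by
  have hρ := redPerm_eq_of_rowRank h2 h2' ht
  let y : Fin m ⊕ Fin c → (Fin (T + 2) ×ₗ Fin m) ⊕ Fin ((T + K + 2) * c) :=
    Sum.map (fun i => toLex (⟨t + 1, by omega⟩, (ρ (t + 1)).1.symm i))
      fun j => finProdFinEquiv (⟨t + K + 2, by omega⟩, j)
  have hy : ∀ (Q : ℕ → Shuffle m c) (ρ' : ℕ → RedPerm m a) (_ : ρ (t + 1) = ρ' (t + 1)) i,
      rowKey Q ρ' (y i) = (m + c) * (t + 1 + (K + 2)) + (Q (t + 1)).1 i := by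
    rintro Q ρ' h (i | j)
    · simp [y, rowKey, ← h]
    · have h : finProdFinEquiv.symm (finProdFinEquiv ((⟨t + K + 2, by omega⟩ : Fin (T + K + 2)), j)) =
          (⟨t + K + 2, by omega⟩, j) := Equiv.symm_apply_apply _ _
      rw [finProdFinEquiv_symm_apply, Prod.mk.injEq] at h
      simp only [y, Sum.map_inr, rowKey, h.1, h.2]
      rw [show t + K + 2 + 1 = t + 1 + (K + 2) by omega, Nat.add_sub_cancel]
  refine Subtype.ext (equiv_eq_of_lt_iff fun i j => ?_)
  have h3 := (h2 (y i) (y j)).symm.trans (h2' (y i) (y j))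
  rwa [hy _ _ rfl, hy _ _ rfl, hy _ _ hρ, hy _ _ hρ, Nat.add_lt_add_iff_left,
    Nat.add_lt_add_iff_left, ← Fin.lt_def, ← Fin.lt_def] at h3

end

/-- A finite family, shifted by one and extended by a constant. -/
def pad {α : Type*} (x : α) (A : Fin T → α) (u : ℕ) : α :=
  if h : 1 ≤ u ∧ u ≤ T then A ⟨u - 1, by omega⟩ else x

theorem pad_succ {α : Type*} (x : α) (A : Fin T → α) (t : Fin T) : pad x A (t + 1) = A t := by
  rw [pad, dif_pos (by omega)]
  rfl

theorem pow_le_layAvoid {v : List ℕ} {D : ℕ} (ha : 0 < a) (hv : Gadget v c D K)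
    (ρ₀ : RedPerm m a) (T : ℕ) :
    ((m + c).choose m ^ 2 * Nat.card (RedPerm m a) * D) ^ T ≤
      layAvoid ((T + 2) * m + (T + K + 2) * c) (a :: v) := by
  classical
  obtain ⟨P₀⟩ : Nonempty (Shuffle m c) :=
    (Nat.card_pos_iff.1 ((Nat.choose_pos (Nat.le_add_right m c)).trans_le
      (choose_le_card_shuffle m c))).1
  let Θ := (Fin T → Shuffle m c) × (Fin T → Shuffle m c) × (Fin T → RedPerm m a)
  have : Finite Θ := inferInstanceAs (Finite (_ × _ × _))
  let inst : Fintype Θ := Fintype.ofFinite Θ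
  choose E₁ h1 using fun θ : Θ => exists_colRank (T := T) (K := K) (pad P₀ θ.1)
  choose E₂ h2 using fun θ : Θ => exists_rowRank (T := T) (K := K) (pad P₀ θ.2.1) (pad ρ₀ θ.2.2)
  let G : Θ → Type := fun θ => {π : Equiv.Perm (Fin ((T + K + 2) * c)) //
      (∀ k : Fin ((T + K + 2) * c), CoversNat (E₁ θ) (E₂ θ) a k (π k)) ∧
      ¬ ∃ C : Set (Fin ((T + K + 2) * c)),
        HasLayers (fun i : Fin ((T + K + 2) * c) => (i : ℕ)) (fun i => (π i : ℕ)) v C ∧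
          ∀ k ∈ C, ∀ k' ∈ C, CoversNat (E₁ θ) (E₂ θ) a k (π k')}
  have hG : ∀ θ, D ^ T ≤ Nat.card (G θ) := fun θ =>
    hv T (CoversNat (E₁ θ) (E₂ θ) a)
      (fun _ _ _ _ hk hr h => h.mono (strictMono_col_inr (h1 θ)) (strictMono_row_inr (h2 θ)) hk hr)
      (fun _ _ => coversNat_of_lt (h1 θ) (h2 θ)) (fun _ _ => CoversNat.lt (h1 θ) (h2 θ) ha)
  have hcol : ∀ θ (π : G θ), IsColoring (E₁ θ) (E₂ θ) π.1 a := fun θ π =>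
    ⟨strictMono_col_inr (h1 θ), strictMono_row_inr (h2 θ), not_hasLayers_red (h1 θ) (h2 θ) ha,
      fun k => coversNat_iff.1 (π.2.1 k)⟩
  have hΦ := Nat.card_le_card_of_injective
    (α := Σ θ, G θ) (fun π => (⟨glue (E₁ π.1) (E₂ π.1) π.2.1, (hcol π.1 π.2).avoids (by
      simpa only [coversNat_iff] using π.2.2.2)⟩ : {p : Equiv.Perm (Fin _) //
        ¬ HasLayers (fun i : Fin ((T + 2) * m + (T + K + 2) * c) => (i : ℕ))
          (fun i => (p i : ℕ)) (a :: v) Set.univ})) (by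
    rintro ⟨θ, π⟩ ⟨θ', π'⟩ h
    obtain ⟨e1, e2, e3⟩ := (hcol θ π).eq_of_glue_eq (hcol θ' π') (strictMono_col_inl (h1 θ))
      (strictMono_col_inl (h1 θ')) (Subtype.ext_iff.1 h)
    have h1' := h1 θ'
    have h2' := h2 θ'
    rw [← e1] at h1'
    rw [← e2] at h2'
    obtain rfl : θ = θ' := by
      refine Prod.ext ?_ (Prod.ext ?_ ?_) <;> funext t
      · simpa only [pad_succ] using shuffle_eq_of_colRank (h1 θ) h1' t.2
      · simpa only [pad_succ] using shuffle_eq_of_rowRank (h2 θ) h2' t.2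
      · simpa only [pad_succ] using redPerm_eq_of_rowRank (h2 θ) h2' t.2
    rw [Subtype.ext e3])
  refine le_trans ?_ hΦ
  rw [Nat.card_sigma]
  calc ((m + c).choose m ^ 2 * Nat.card (RedPerm m a) * D) ^ T
      ≤ (Nat.card (Shuffle m c) ^ 2 * Nat.card (RedPerm m a) * D) ^ T := by
        gcongr
        exact choose_le_card_shuffle m c
    _ = Nat.card Θ * D ^ T := by
        simp only [Θ, Nat.card_prod, Nat.card_fun, Nat.card_eq_fintype_card (α := Fin T),
          Fintype.card_fin]
        ring
    _ = ∑ _θ : Θ, D ^ T := by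
        rw [Finset.sum_const, smul_eq_mul, Finset.card_univ, Nat.card_eq_fintype_card]
    _ ≤ ∑ θ : Θ, Nat.card (G θ) := Finset.sum_le_sum fun θ _ => hG θ

end Coloring

namespace Coloring

theorem layAvoid_le_card_redPerm {a : ℕ} (ha : 0 < a) (m : ℕ) :
    layAvoid m [a, 1] ≤ Nat.card (RedPerm (m + a) a) := by
  let τ : Equiv.Perm (Fin m) → Equiv.Perm (Fin (m + a)) := fun p =>
    finSumFinEquiv.symm.trans ((p.sumCongr (Equiv.refl (Fin a))).trans finSumFinEquiv)
  have hl : ∀ p i, τ p (Fin.castAdd a i) = Fin.castAdd a (p i) := fun p i => by simp [τ]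
  have hr : ∀ p i, τ p (Fin.natAdd m i) = Fin.natAdd m i := fun p i => by simp [τ]
  have hblk : ∀ p i, (τ p i : ℕ) < m ↔ (i : ℕ) < m := fun p i => by
    induction i using Fin.addCases with
    | left i => simp [hl]
    | right i => simp [hr]
  refine Nat.card_le_card_of_injective (fun p => ⟨τ p.1, fun h => ?_, Fin.natAdd m,
    Fin.strictMono_natAdd m, ?_⟩) fun p p' h => ?_
  · obtain ⟨t, ht⟩ := h.exists_block (blk := fun i : Fin (m + a) => if (i : ℕ) < m then 0 else 1)
      ha one_pos
      (fun (i : Fin (m + a)) _ (j : Fin (m + a)) _ (hij : (i : ℕ) < j) => by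
        split_ifs <;> omega)
      (fun (i : Fin (m + a)) _ (j : Fin (m + a)) _ (hij : (τ p.1 i : ℕ) < τ p.1 j) => by
        have h1 := hblk p.1 i
        have h2 := hblk p.1 j
        split_ifs <;> omega)
    by_cases h0 : t = 0
    · subst h0
      have h1 := ht.preimage (Fin.castAdd a) fun i hi => by
        have h2 : (i : ℕ) < m := by
          by_contra h3
          simpa [h3] using hi.2
        exact ⟨⟨i, h2⟩, rfl⟩
      simp only [hl, Fin.val_castAdd] at h1
      exact p.2 (h1.mono (Set.subset_univ _))
    · obtain ⟨f, C, h1, -, -, h2, h3, h4⟩ := ht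
      obtain ⟨i, hi⟩ := h3.nonempty one_pos
      have h5 : ∀ i : Fin (m + a), (if (i : ℕ) < m then 0 else 1) = t → τ p.1 i = i := fun i hi => by
        induction i using Fin.addCases with
        | left i => simp at hi; omega
        | right i => exact hr _ _
      have h6 := h4 ⟨0, ha⟩ i hi
      dsimp only at h6
      rw [h5 _ (h1 _).2, h5 _ (h2 hi).2] at h6
      omega
  · simpa only [Function.comp_def, hr] using Fin.strictMono_natAdd m
  · refine Subtype.ext (Equiv.ext fun i => Fin.castAdd_injective m a ?_)
    rw [← hl, ← hl]
    exact Equiv.congr_fun (Subtype.ext_iff.1 h) _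

end Coloring

theorem one_le_layAvoid {a b : ℕ} {l : List ℕ} (ha : 0 < a) (hb : 0 < b) (n : ℕ) :
    1 ≤ layAvoid n (a :: b :: l) := by
  induction n with
  | zero =>
    refine Nat.card_pos_iff.2 ⟨⟨1, fun h => ?_⟩, inferInstance⟩
    exact (h.nonempty ha).choose.elim0
  | succ n ih => exact ih.trans (layAvoid_le_succ ha hb n)

theorem exists_mul_pow_le_layAvoid {a b : ℕ} {l : List ℕ} (ha : 0 < a) (hb : 0 < b) {y : ℝ}
    (hy : 0 < y) {W C : ℕ} (hW : 0 < W)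
    (h : ∀ T, (y ^ (2 * W)) ^ T ≤ layAvoid (W * T + C) (a :: b :: l)) :
    ∃ δ : ℝ, 0 < δ ∧ ∀ n : ℕ, δ * y ^ (2 * n) ≤ layAvoid n (a :: b :: l) := by
  refine ⟨((1 + y) ^ (2 * (C + W)))⁻¹, by positivity, fun n => ?_⟩
  have hmono := monotone_nat_of_le_succ (layAvoid_le_succ (l := l) ha hb)
  set T := (n - C) / W
  have h1 : W * T ≤ n - C := Nat.mul_div_le _ _
  have h2 : n - C < W * T + W := Nat.lt_mul_div_succ _ hW
  have h3 : (y ^ (2 * W)) ^ T ≤ layAvoid n (a :: b :: l) := by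
    by_cases hn : C ≤ n
    · exact (h T).trans (by exact_mod_cast hmono (by omega))
    · have h4 : T = 0 := by
        simp only [T]
        rw [Nat.sub_eq_zero_of_le (by omega), Nat.zero_div]
      rw [h4, pow_zero]
      exact_mod_cast one_le_layAvoid ha hb n
  rw [inv_mul_le_iff₀ (by positivity)]
  obtain ⟨d, hd⟩ : ∃ d, n = W * T + d := ⟨n - W * T, by omega⟩
  calc y ^ (2 * n) = y ^ (2 * d) * (y ^ (2 * W)) ^ T := by rw [hd]; ring
    _ ≤ (1 + y) ^ (2 * (C + W)) * layAvoid n (a :: b :: l) := by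
      refine mul_le_mul ?_ h3 (by positivity) (by positivity)
      exact (pow_le_pow_left₀ hy.le (by linarith) _).trans
        (pow_le_pow_right₀ (by linarith) (by omega))

theorem exists_pow_le_choose_mul {y₁ y₂ : ℝ} (w : ℕ) :
    ∃ m c : ℕ, m + c = w ∧
      (y₁ + y₂) ^ w ≤ ((w : ℝ) + 1) * ((w.choose m : ℝ) * y₁ ^ m * y₂ ^ c) := by
  obtain ⟨m, hm, h⟩ := Finset.exists_le_of_sum_le (s := Finset.range (w + 1))
    (f := fun _ => (y₁ + y₂) ^ w / ((w : ℝ) + 1))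
    (g := fun m => (w.choose m : ℝ) * y₁ ^ m * y₂ ^ (w - m)) ⟨0, by simp⟩ (by
      rw [Finset.sum_const, Finset.card_range, nsmul_eq_mul, Nat.cast_add_one,
        mul_div_cancel₀ _ (by positivity), add_pow]
      exact (Finset.sum_congr rfl fun m _ => by ring).le)
  rw [div_le_iff₀' (by positivity)] at h
  exact ⟨m, w - m, by have := Finset.mem_range.1 hm; omega, h⟩

theorem Grows.cons {a b : ℕ} {l : List ℕ} {x₁ x₂ : ℝ} (ha : 0 < a) (hb : 0 < b) (hx₁ : 0 < x₁)
    (hx₂ : 0 < x₂) (h₁ : Grows [a, 1] x₁) (h₂ : GadgetGrows (b :: l) x₂) :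
    Grows (a :: b :: l) (x₁ + x₂) := by
  intro y hy hyx
  obtain ⟨t, ht, ht1⟩ := exists_between ((div_lt_one (add_pos hx₁ hx₂)).2 hyx)
  rw [div_lt_iff₀ (add_pos hx₁ hx₂)] at ht
  have ht0 : 0 < t := by
    by_contra! h
    nlinarith
  obtain ⟨δ₁, hδ₁, H₁⟩ := h₁ (t * x₁) (by positivity) (mul_lt_of_lt_one_left hx₁ ht1)
  obtain ⟨δ₂, hδ₂, H₂⟩ := h₂ (t * x₂) (by positivity) (mul_lt_of_lt_one_left hx₂ ht1)
  set y₁ := t * x₁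
  set y₂ := t * x₂
  have hy₁ : 0 < y₁ := by positivity
  have hy₂ : 0 < y₂ := by positivity
  replace ht : y < y₁ + y₂ := by rw [← mul_add]; exact ht
  obtain ⟨δ, hδ, H⟩ := exists_mul_pow_le (pow_pos hy 2) (pow_lt_pow_left₀ ht hy.le two_ne_zero) 3
  obtain ⟨w, hw⟩ := exists_nat_ge (y ^ (2 * a) / (δ₁ * δ₂ * δ))
  rw [div_le_iff₀ (by positivity)] at hw
  obtain ⟨m, c, hmc, hm⟩ := exists_pow_le_choose_mul (y₁ := y₁) (y₂ := y₂) w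
  obtain ⟨D, K, hD, hK⟩ := H₂ c
  have hR : δ₁ * y₁ ^ (2 * m) ≤ Nat.card (Coloring.RedPerm (m + a) a) :=
    (H₁ m).trans (by exact_mod_cast Coloring.layAvoid_le_card_redPerm ha m)
  obtain ⟨ρ₀⟩ : Nonempty (Coloring.RedPerm (m + a) a) := by
    refine (Nat.card_pos_iff.1 ?_).1
    exact_mod_cast (by positivity : 0 < δ₁ * y₁ ^ (2 * m)).trans_le hR
  have hch : w.choose m ≤ (m + a + c).choose (m + a) := by
    rw [← hmc, Nat.choose_symm_add, Nat.choose_symm_add]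
    exact Nat.choose_le_choose c (by omega)
  refine exists_mul_pow_le_layAvoid ha hb hy (W := w + a) (C := 2 * (m + a) + (K + 2) * c)
    (by omega) fun T => ?_
  have key := Coloring.pow_le_layAvoid ha hK ρ₀ T
  rw [show (T + 2) * (m + a) + (T + K + 2) * c = (w + a) * T + (2 * (m + a) + (K + 2) * c) by
    rw [← hmc]; ring] at key
  refine le_trans ?_ (Nat.cast_le (α := ℝ).2 key)
  push_cast
  refine pow_le_pow_left₀ (by positivity) ?_ T
  have hw1 : (0 : ℝ) < (w : ℝ) + 1 := by positivity
  calc y ^ (2 * (w + a)) = y ^ (2 * a) * (y ^ 2) ^ w := by ring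
    _ ≤ ((w : ℝ) + 1) * (δ₁ * δ₂ * δ) * (y ^ 2) ^ w := by
      gcongr
      nlinarith [mul_pos (mul_pos hδ₁ hδ₂) hδ]
    _ = δ₁ * δ₂ / ((w : ℝ) + 1) ^ 2 * (δ * ((w : ℝ) + 1) ^ 3 * (y ^ 2) ^ w) := by
      field_simp
    _ ≤ δ₁ * δ₂ / ((w : ℝ) + 1) ^ 2 * ((y₁ + y₂) ^ 2) ^ w := by
      gcongr
      exact H w
    _ = δ₁ * δ₂ / ((w : ℝ) + 1) ^ 2 * ((y₁ + y₂) ^ w) ^ 2 := by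
      rw [← pow_mul, ← pow_mul, mul_comm 2 w]
    _ ≤ δ₁ * δ₂ / ((w : ℝ) + 1) ^ 2 *
        (((w : ℝ) + 1) * ((w.choose m : ℝ) * y₁ ^ m * y₂ ^ c)) ^ 2 := by gcongr
    _ = (w.choose m : ℝ) ^ 2 * (δ₁ * y₁ ^ (2 * m)) * (δ₂ * y₂ ^ (2 * c)) := by
      field_simp
      ring
    _ ≤ _ := by gcongr

theorem Grows.cons_single {a s : ℕ} (ha : 0 < a) (hs : 0 < s) (h : Grows [a, 1] a) :
    Grows [a, s] ((a : ℝ) + ((s : ℝ) - 1)) := by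
  rcases (show 1 ≤ s from hs).eq_or_lt with rfl | hs2
  · simpa using h
  · exact h.cons ha hs (by exact_mod_cast ha) (by rw [sub_pos]; exact_mod_cast hs2)
      (gadgetGrows_single hs2)

theorem grows_cons_one {a : ℕ} (ha : 0 < a) : Grows [a, 1] a := by
  have h := Grows.cons_single one_pos ha (by simpa using grows_one_one)
  rw [Nat.cast_one, add_sub_cancel] at h
  exact h.of_le fun n => layAvoid_one_cons_le_swap n a

theorem grows_cons_cons (l : List ℕ) : ∀ {a b : ℕ}, 0 < a → 0 < b → (∀ c ∈ l, 0 < c) →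
    Grows (a :: b :: l) ((((a :: b :: l).sum : ℕ) : ℝ) - 1) := by
  induction l with
  | nil =>
    intro a b ha hb _
    simpa [add_sub_assoc] using (grows_cons_one ha).cons_single ha hb
  | cons c l ih =>
    intro a b ha hb hl
    have hc := hl c List.mem_cons_self
    have h := ih hb hc fun d hd => hl d (List.mem_cons_of_mem _ hd)
    have hpos : (0 : ℝ) < (((b :: c :: l).sum : ℕ) : ℝ) - 1 := by
      rw [sub_pos, Nat.one_lt_cast]
      simp only [List.sum_cons]
      omega
    have := (grows_cons_one ha).cons ha hb (by exact_mod_cast ha) hpos (h.gadgetGrows hb hc)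
    rw [List.sum_cons (a := a), Nat.cast_add, add_sub_assoc]
    exact this

theorem grows_of_pos : ∀ {l : List ℕ}, (∀ a ∈ l, 0 < a) → 2 ≤ l.sum → Grows l ((l.sum : ℝ) - 1)
  | [], _, h => by simp at h
  | [k], _, h => by
    rw [List.sum_singleton] at h ⊢
    obtain ⟨k, rfl⟩ := Nat.exists_eq_add_of_le' h
    refine Grows.of_le ?_ fun n => layAvoid_replicate_one_le n _
    have := grows_cons_cons (List.replicate k 1) one_pos one_pos fun c hc =>
      (List.eq_of_mem_replicate hc).symm ▸ one_pos
    rw [← List.replicate_succ, ← List.replicate_succ, List.sum_replicate, smul_eq_mul,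
      mul_one] at this
    exact this
  | a :: b :: l, hl, _ => grows_cons_cons l (hl a (by simp)) (hl b (by simp)) fun c hc =>
    hl c (by simp [hc])

theorem sq_le_liminf_rpow {u : ℕ → ℕ} {x b : ℝ} (hx : 0 < x)
    (hb : ∃ᶠ n : ℕ in Filter.atTop, (u n : ℝ) ^ (1 / (n : ℝ)) ≤ b)
    (h : ∀ y : ℝ, 0 < y → y < x → ∃ δ : ℝ, 0 < δ ∧ ∀ n : ℕ, δ * y ^ (2 * n) ≤ u n) :
    x ^ 2 ≤ Filter.liminf (fun n : ℕ => (u n : ℝ) ^ (1 / (n : ℝ))) Filter.atTop := by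
  have hco : Filter.IsCoboundedUnder (· ≥ ·) Filter.atTop
      fun n : ℕ => (u n : ℝ) ^ (1 / (n : ℝ)) := Filter.IsCobounded.of_frequently_le hb
  have key : ∀ y : ℝ, 0 < y → y < x →
      y ^ 2 ≤ Filter.liminf (fun n : ℕ => (u n : ℝ) ^ (1 / (n : ℝ))) Filter.atTop := by
    intro y hy hyx
    obtain ⟨δ, hδ, H⟩ := h y hy hyx
    have hlim : Filter.Tendsto (fun n : ℕ => δ ^ (1 / (n : ℝ)) * y ^ 2) Filter.atTop
        (nhds (y ^ 2)) := by
      have h1 := (tendsto_const_nhds (x := δ)).rpow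
        (tendsto_one_div_atTop_nhds_zero_nat (𝕜 := ℝ)) (Or.inl hδ.ne')
      simpa using h1.mul_const (y ^ 2)
    refine le_of_forall_lt fun z hz => ?_
    obtain ⟨z', hzz', hz'⟩ := exists_between hz
    refine hzz'.trans_le (Filter.le_liminf_of_le hco ?_)
    filter_upwards [hlim.eventually_const_lt hz', Filter.eventually_gt_atTop 0] with n hn hn0
    calc z' ≤ δ ^ (1 / (n : ℝ)) * y ^ 2 := hn.le
      _ = (δ * y ^ (2 * n)) ^ (1 / (n : ℝ)) := by
        rw [Real.mul_rpow hδ.le (by positivity), pow_mul, one_div,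
          Real.pow_rpow_inv_natCast (by positivity) hn0.ne']
      _ ≤ _ := Real.rpow_le_rpow (by positivity) (H n) (by positivity)
  refine le_of_forall_lt fun z hz => ?_
  have hc : Filter.Tendsto (fun y : ℝ => y ^ 2) (nhdsWithin x (Set.Iio x)) (nhds (x ^ 2)) :=
    ((continuous_pow 2).tendsto x).mono_left nhdsWithin_le_nhds
  obtain ⟨y, hy1, hy2⟩ := ((hc.eventually_const_lt hz).and (Ioo_mem_nhdsLT hx)).exists
  exact hy1.trans_le (key y hy2.1 hy2.2)

/-- If `q` is a layered pattern of length `k ≥ 1`, then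
`liminf (S_n(q))^{1/n} ≥ (k-1)²`. -/
theorem stanley_wilf_layered_lower {k : ℕ} (hk : 1 ≤ k)
    (q : Equiv.Perm (Fin k)) (hq : Layered q) :
    ((k : ℝ) - 1) ^ 2 ≤
      Filter.liminf (fun n : ℕ => (avoiders n q : ℝ) ^ (1 / (n : ℝ))) Filter.atTop := by
  obtain ⟨b, hb⟩ := exists_frequently_avoiders_rpow_le hk q
  rcases hk.eq_or_lt with rfl | hk2
  · refine Filter.le_liminf_of_le (Filter.IsCobounded.of_frequently_le hb)
      (Filter.Eventually.of_forall fun n => ?_)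
    simp only [Nat.cast_one, sub_self, ne_eq, OfNat.ofNat_ne_zero, not_false_eq_true, zero_pow]
    positivity
  · obtain ⟨l, hl, hsum, h⟩ := exists_layers q hq Finset.univ
    rw [Finset.card_univ, Fintype.card_fin] at hsum
    rw [Finset.coe_univ] at h
    have hg := grows_of_pos hl (hsum ▸ hk2)
    rw [hsum] at hg
    refine sq_le_liminf_rpow (by rw [sub_pos]; exact_mod_cast hk2) hb fun y hy hyk => ?_
    obtain ⟨δ, hδ, H⟩ := hg y hy hyk
    exact ⟨δ, hδ, fun n => (H n).trans (by exact_mod_cast layAvoid_le_avoiders q h n)⟩
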